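/- Let m ≥ l ≥ 0 be integers, let p ∈ ℂ with 0 < |p| < 1, let σ ∈ ℂ be nonzero and set q = σ², and let t_0, t_1, t_2, t_3, x_1, ..., x_m, y_1, ..., y_l ∈ ℂ, all nonzero, with q^{m−l} t_0 t_1 t_2 t_3 = q. Assume θ(x_i²;p) ≠ 0 for all i, θ(x_i x_j;p) ≠ 0 and θ(x_i/x_j;p) ≠ 0 for i < j, θ(y_i²;p) ≠ 0 for all i, θ(y_i y_j;p) ≠ 0 and θ(y_i/y_j;p) ≠ 0 for i < j. Then Σ_{ε ∈ {±1}^m} ∏_{i=1}^{m} θ(t_0 x_i^{ε_i};p) θ(t_1 x_i^{ε_i};p) θ(t_2 x_i^{ε_i};p) θ(t_3 x_i^{ε_i};p) · ( ∏_{r=1}^{l} θ(x_i^{ε_i} y_r/σ;p) θ(x_i^{ε_i}/(σ y_r);p) ) / ( x_i^{(l+1)ε_i} θ(x_i^{2ε_i};p) ) · ∏_{1≤i<j≤m} θ(q x_i^{ε_i} x_j^{ε_j};p)/θ(x_i^{ε_i} x_j^{ε_j};p) = ∏_{i=0}^{m−l−1} ( θ(q^i t_0 t_1;p) θ(q^i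 t_0 t_2;p) θ(q^i t_0 t_3;p) / ((−σ)^{m−1} t_0) ) · Σ_{δ ∈ {±1}^l} ∏_{i=1}^{l} θ(σ y_i^{δ_i}/t_0;p) θ(σ y_i^{δ_i}/t_1;p) θ(σ y_i^{δ_i}/t_2;p) θ(σ y_i^{δ_i}/t_3;p) · ( ∏_{r=1}^{m} θ(y_i^{δ_i} x_r/σ;p) θ(y_i^{δ_i}/(σ x_r);p) ) / ( y_i^{(m+1)δ_i} θ(y_i^{2δ_i};p) ) · ∏_{1≤i<j≤l} θ(q y_i^{δ_i} y_j^{δ_j};p)/θ(y_i^{δ_i} y_j^{δ_j};p). -/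

import Mathlib

open scoped BigOperators Real

/-- The theta function `θ(x;p)`. -/
noncomputable def ellTheta (x p : ℂ) : ℂ :=
  ∏' k : ℕ, ((1 - p ^ k * x) * (1 - p ^ (k + 1) / x))

/-- `z^{ε}`: `z` if the sign is `+1` (`true`), `z⁻¹` if the sign is `−1` (`false`). -/
noncomputable def pw (z : ℂ) (b : Bool) : ℂ := if b then z else z⁻¹

/-! ### The theta function -/

/-- The infinite product `∏_{k ≥ 0} (1 - p^k x)`. -/
noncomputable def pochInf (x p : ℂ) : ℂ := ∏' k : ℕ, (1 - p ^ k * x)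

section Theta

variable {p : ℂ}

theorem summable_norm_pow_mul (hp1 : ‖p‖ < 1) (x : ℂ) :
    Summable fun k : ℕ => ‖-(p ^ k * x)‖ := by
  simpa using (summable_geometric_of_lt_one (norm_nonneg _) hp1).mul_right ‖x‖

theorem multipliable_one_sub_pow_mul (hp1 : ‖p‖ < 1) (x : ℂ) :
    Multipliable fun k : ℕ => 1 - p ^ k * x := by
  simpa only [sub_eq_add_neg] using
    multipliable_one_add_of_summable (summable_norm_pow_mul hp1 x)

theorem pochInf_eq (hp1 : ‖p‖ < 1) (x : ℂ) :
    pochInf x p = (1 - x) * pochInf (p * x) p := by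
  have h : (fun k : ℕ => 1 - p ^ (k + 1) * x) = fun k : ℕ => 1 - p ^ k * (p * x) := by
    ext k
    ring
  unfold pochInf
  rw [tprod_eq_zero_mul', h]
  · simp
  · rw [h]
    exact multipliable_one_sub_pow_mul hp1 _

theorem pochInf_ne_zero (hp1 : ‖p‖ < 1) {x : ℂ} (hx : ∀ k : ℕ, p ^ k * x ≠ 1) :
    pochInf x p ≠ 0 := by
  have := tprod_one_add_ne_zero_of_summable (f := fun k : ℕ => -(p ^ k * x))
    (fun k => by
      rw [← sub_eq_add_neg]
      exact sub_ne_zero.2 (hx k).symm) (summable_norm_pow_mul hp1 x)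
  simpa only [pochInf, sub_eq_add_neg] using this

theorem differentiable_pochInf (hp1 : ‖p‖ < 1) : Differentiable ℂ fun x => pochInf x p := by
  intro z
  have h := Summable.hasProdLocallyUniformlyOn_nat_one_add (K := Metric.ball (0 : ℂ) (‖z‖ + 1))
    (f := fun (k : ℕ) (x : ℂ) => -(p ^ k * x)) Metric.isOpen_ball
    ((summable_geometric_of_lt_one (norm_nonneg _) hp1).mul_right (‖z‖ + 1))
    (.of_forall fun k x hx => by
      have : ‖x‖ ≤ ‖z‖ + 1 := by simpa using (Metric.mem_ball.1 hx).le
      rw [norm_neg, norm_mul, norm_pow]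
      gcongr) (fun k => by fun_prop)
  have hd := h.differentiableOn
    (.of_forall fun _ => by
      simpa [Finset.prod_fn] using DifferentiableOn.finsetProd (fun _ _ => by fun_prop))
    Metric.isOpen_ball
  have hz : Metric.ball (0 : ℂ) (‖z‖ + 1) ∈ nhds z := Metric.isOpen_ball.mem_nhds (by simp)
  simpa only [pochInf, sub_eq_add_neg] using hd.differentiableAt hz

theorem ellTheta_eq (hp1 : ‖p‖ < 1) (x : ℂ) :
    ellTheta x p = pochInf x p * pochInf (p / x) p := by
  unfold ellTheta pochInf
  rw [← Multipliable.tprod_mul (multipliable_one_sub_pow_mul hp1 _)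
    (multipliable_one_sub_pow_mul hp1 _)]
  congr! 3 with k
  ring

theorem ellTheta_one (hp1 : ‖p‖ < 1) : ellTheta 1 p = 0 := by
  rw [ellTheta_eq hp1, pochInf_eq hp1]
  simp

theorem ellTheta_mul_left (hp0 : p ≠ 0) (hp1 : ‖p‖ < 1) {x : ℂ} (hx : x ≠ 0) :
    ellTheta (p * x) p = -x⁻¹ * ellTheta x p := by
  have h1 : p / (p * x) = x⁻¹ := by field_simp
  have h2 : p * x⁻¹ = p / x := by ring
  rw [ellTheta_eq hp1, ellTheta_eq hp1, h1, pochInf_eq hp1 x⁻¹, pochInf_eq hp1 x, h2]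
  field_simp
  ring

theorem ellTheta_inv (hp0 : p ≠ 0) (hp1 : ‖p‖ < 1) {x : ℂ} (hx : x ≠ 0) :
    ellTheta x⁻¹ p = -x⁻¹ * ellTheta x p := by
  have h1 : p / (p * x) = x⁻¹ := by field_simp
  rw [← ellTheta_mul_left hp0 hp1 hx, ellTheta_eq hp1, ellTheta_eq hp1, h1, div_inv_eq_mul,
    mul_comm]

theorem ellTheta_inv_ne_zero (hp0 : p ≠ 0) (hp1 : ‖p‖ < 1) {x : ℂ} (hx : x ≠ 0)
    (h : ellTheta x p ≠ 0) : ellTheta x⁻¹ p ≠ 0 := by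
  rw [ellTheta_inv hp0 hp1 hx]
  exact mul_ne_zero (neg_ne_zero.2 (inv_ne_zero hx)) h

theorem ellTheta_zpow (hp0 : p ≠ 0) (hp1 : ‖p‖ < 1) (k : ℤ) : ellTheta (p ^ k) p = 0 := by
  induction k using Int.induction_on with
  | zero => simpa using ellTheta_one hp1
  | succ n ih =>
    rw [zpow_add_one₀ hp0, mul_comm, ellTheta_mul_left hp0 hp1 (zpow_ne_zero _ hp0), ih, mul_zero]
  | pred n ih =>
    have h := ellTheta_mul_left hp0 hp1 (zpow_ne_zero (-(n : ℤ) - 1) hp0)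
    rw [← zpow_one_add₀ hp0, show (1 : ℤ) + (-(n : ℤ) - 1) = -n by ring, ih] at h
    exact (mul_eq_zero.1 h.symm).resolve_left
      (neg_ne_zero.2 (inv_ne_zero (zpow_ne_zero _ hp0)))

theorem exists_zpow_of_ellTheta_eq_zero (hp0 : p ≠ 0) (hp1 : ‖p‖ < 1) {x : ℂ} (hx : x ≠ 0)
    (h : ellTheta x p = 0) : ∃ k : ℤ, x = p ^ k := by
  rw [ellTheta_eq hp1] at h
  rcases mul_eq_zero.1 h with h | h
  · by_contra! hne
    refine pochInf_ne_zero hp1 (fun k hk => hne (-k) ?_) h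
    rw [zpow_neg, zpow_natCast]
    exact eq_inv_of_mul_eq_one_right hk
  · by_contra! hne
    refine pochInf_ne_zero hp1 (fun k hk => hne (k + 1) ?_) h
    rw [zpow_add_one₀ hp0, zpow_natCast]
    field_simp at hk
    rw [← hk]

theorem differentiableAt_ellTheta (hp1 : ‖p‖ < 1) {z : ℂ} (hz : z ≠ 0) :
    DifferentiableAt ℂ (fun x => ellTheta x p) z := by
  simp only [ellTheta_eq hp1]
  exact (differentiable_pochInf hp1 z).mul
    ((differentiable_pochInf hp1 (p / z)).comp z
      ((differentiableAt_const p).div differentiableAt_id hz))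

theorem deriv_ellTheta_zpow_ne_zero (hp0 : p ≠ 0) (hp1 : ‖p‖ < 1) (k : ℤ) :
    deriv (fun x => ellTheta x p) (p ^ k) ≠ 0 := by
  have step (j : ℤ) : p ^ j * (p * deriv (fun x => ellTheta x p) (p ^ (j + 1))) =
      -deriv (fun x => ellTheta x p) (p ^ j) := by
    have hj := zpow_ne_zero j hp0
    have h1 : HasDerivAt (fun x => ellTheta (p * x) p)
        (p * deriv (fun x => ellTheta x p) (p ^ (j + 1))) (p ^ j) := by
      have h := (differentiableAt_ellTheta hp1 (zpow_ne_zero (j + 1) hp0)).hasDerivAt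
      rw [mul_comm p]
      refine HasDerivAt.comp (h₂ := fun x => ellTheta x p) (p ^ j) ?_
        (by simpa using (hasDerivAt_id (p ^ j)).const_mul p)
      rwa [← zpow_one_add₀ hp0, add_comm 1 j]
    have h2 := (hasDerivAt_id (p ^ j)).mul h1
    have h3 := (differentiableAt_ellTheta hp1 hj).hasDerivAt.neg
    have heq : (id * fun x => ellTheta (p * x) p) =ᶠ[nhds (p ^ j)]
        -fun x => ellTheta x p := by
      filter_upwards [isOpen_ne.mem_nhds hj] with x hx
      simp only [Pi.mul_apply, id, Pi.neg_apply]
      rw [ellTheta_mul_left hp0 hp1 hx]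
      have : x ≠ 0 := hx
      field_simp
    have h4 := h2.unique (h3.congr_of_eventuallyEq heq)
    rw [← zpow_one_add₀ hp0, ellTheta_zpow hp0 hp1] at h4
    simpa using h4
  have base : deriv (fun x => ellTheta x p) 1 ≠ 0 := by
    have hg : DifferentiableAt ℂ (fun x => pochInf (p * x) p * pochInf (p / x) p) 1 := by
      refine DifferentiableAt.mul ?_ ?_
      · exact (differentiable_pochInf hp1 (p * 1)).comp 1
          ((differentiableAt_const p).mul differentiableAt_id)
      · exact (differentiable_pochInf hp1 (p / 1)).comp 1
          ((differentiableAt_const p).div differentiableAt_id one_ne_zero)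
    have h1 := ((hasDerivAt_id (1 : ℂ)).const_sub 1).mul hg.hasDerivAt
    have h2 : (fun x => ellTheta x p) =
        (fun x => 1 - id x) * fun x => pochInf (p * x) p * pochInf (p / x) p := by
      ext x
      simp only [Pi.mul_apply, id]
      rw [ellTheta_eq hp1, pochInf_eq hp1 x, mul_assoc]
    rw [h2, h1.deriv]
    have hpoch : pochInf p p ≠ 0 := pochInf_ne_zero hp1 fun k hk => by
      have h := congrArg norm hk
      rw [← pow_succ, norm_pow, norm_one] at h
      exact absurd h (pow_lt_one₀ (norm_nonneg _) hp1 (Nat.succ_ne_zero k)).ne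
    simpa using hpoch
  induction k using Int.induction_on with
  | zero => simpa using base
  | succ n ih =>
    intro h
    have := step n
    rw [h] at this
    exact ih (by simpa using this)
  | pred n ih =>
    intro h
    have := step (-(n : ℤ) - 1)
    rw [h, sub_add_cancel] at this
    simp only [neg_zero, mul_eq_zero, hp0, false_or] at this
    rcases this with h' | h'
    · exact zpow_ne_zero _ hp0 h'
    · exact ih h'

end Theta

/-! ### Quasi-periodic functions on the punctured plane -/

section QuasiPeriodic

open Filter Topology

variable {p : ℂ}

theorem ellTheta_div_eq_zero_or_hasDerivAt (hp0 : p ≠ 0) (hp1 : ‖p‖ < 1) {b z : ℂ} (hb : b ≠ 0)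
    (hz : z ≠ 0) : ellTheta (z / b) p ≠ 0 ∨ ∃ k : ℤ, z = p ^ k * b ∧
      deriv (fun x => ellTheta (x / b) p) z ≠ 0 := by
  by_cases h : ellTheta (z / b) p = 0
  · right
    obtain ⟨k, hk⟩ := exists_zpow_of_ellTheta_eq_zero hp0 hp1 (div_ne_zero hz hb) h
    refine ⟨k, (div_eq_iff hb).1 hk, ?_⟩
    have h1 := (differentiableAt_ellTheta hp1 (div_ne_zero hz hb)).hasDerivAt
    have h2 : HasDerivAt (fun x => ellTheta (x / b) p) _ z :=
      HasDerivAt.comp (h₂ := fun x => ellTheta x p) z h1 ((hasDerivAt_id z).div_const b)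
    rw [h2.deriv, hk]
    exact mul_ne_zero (deriv_ellTheta_zpow_ne_zero hp0 hp1 k) (one_div_ne_zero hb)
  · exact Or.inl h

theorem differentiableAt_ellTheta_div (hp1 : ‖p‖ < 1) {b z : ℂ} (hb : b ≠ 0) (hz : z ≠ 0) :
    DifferentiableAt ℂ (fun x => ellTheta (x / b) p) z :=
  DifferentiableAt.comp (g := fun x => ellTheta x p) z
    (differentiableAt_ellTheta hp1 (div_ne_zero hz hb)) (by fun_prop)

theorem eventually_ellTheta_div_ne_zero (hp0 : p ≠ 0) (hp1 : ‖p‖ < 1) {b z : ℂ} (hb : b ≠ 0)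
    (hz : z ≠ 0) : ∀ᶠ x in 𝓝[≠] z, ellTheta (x / b) p ≠ 0 := by
  have hd := differentiableAt_ellTheta_div hp1 hb hz
  rcases ellTheta_div_eq_zero_or_hasDerivAt hp0 hp1 hb hz with h | ⟨k, -, h⟩
  · exact (hd.continuousAt.eventually_ne h).filter_mono nhdsWithin_le_nhds
  · exact hd.hasDerivAt.eventually_ne h

theorem eq_of_ellTheta_div_mul_eq (hp0 : p ≠ 0) (hp1 : ‖p‖ < 1) {b : ℂ} (hb : b ≠ 0)
    {F G : ℂ → ℂ} (hF : ∀ z ≠ 0, DifferentiableAt ℂ F z) (hG : ∀ z ≠ 0, DifferentiableAt ℂ G z)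
    (h : ∀ z ≠ 0, ellTheta (z / b) p * F z = ellTheta (z / b) p * G z) {z : ℂ} (hz : z ≠ 0) :
    F z = G z := by
  refine (((hF z hz).continuousAt.eventuallyEq_nhds_iff_eventuallyEq_nhdsNE
    (hG z hz).continuousAt).1 ?_).self_of_nhds
  filter_upwards [eventually_ellTheta_div_ne_zero hp0 hp1 hb hz,
    mem_nhdsWithin_of_mem_nhds (isOpen_ne.mem_nhds hz)] with x hx hx0
  exact mul_left_cancel₀ hx (h x hx0)

theorem exists_eq_ellTheta_div_mul (hp0 : p ≠ 0) (hp1 : ‖p‖ < 1) {b : ℂ} (hb : b ≠ 0)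
    {F : ℂ → ℂ} (hF : ∀ z ≠ 0, DifferentiableAt ℂ F z) (h : ∀ k : ℤ, F (p ^ k * b) = 0) :
    ∃ G : ℂ → ℂ, (∀ z ≠ 0, DifferentiableAt ℂ G z) ∧
      ∀ z ≠ 0, F z = ellTheta (z / b) p * G z := by
  classical
  set D : ℂ → ℂ := fun x => ellTheta (x / b) p with hD
  have hDd : ∀ z ≠ 0, DifferentiableAt ℂ D z := fun z hz => differentiableAt_ellTheta_div hp1 hb hz
  refine ⟨fun z => if D z = 0 then deriv F z / deriv D z else F z / D z, fun z hz => ?_,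
    fun z hz => ?_⟩
  · rcases ellTheta_div_eq_zero_or_hasDerivAt hp0 hp1 hb hz with h0 | ⟨k, hk, h0⟩
    · refine ((hF z hz).div (hDd z hz) h0).congr_of_eventuallyEq ?_
      filter_upwards [(hDd z hz).continuousAt.eventually_ne h0] with x hx
      simp [hx]
    · have hFz : F z = 0 := hk ▸ h k
      have hDz : D z = 0 := by
        simp only [hD, hk, mul_div_cancel_right₀ _ hb]
        exact ellTheta_zpow hp0 hp1 k
      have hds {f : ℂ → ℂ} (hf : ∀ w ≠ 0, DifferentiableAt ℂ f w) :
          DifferentiableAt ℂ (dslope f z) z := by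
        have hn : {x : ℂ | x ≠ 0} ∈ 𝓝 z := isOpen_ne.mem_nhds hz
        exact ((Complex.differentiableOn_dslope hn).2
          fun w hw => (hf w hw).differentiableWithinAt).differentiableAt hn
      refine ((hds hF).div (hds hDd) (by rwa [dslope_same])).congr_of_eventuallyEq ?_
      have hne := eventually_nhdsWithin_iff.1 (eventually_ellTheta_div_ne_zero hp0 hp1 hb hz)
      filter_upwards [hne] with x hx
      by_cases hxz : x = z
      · subst hxz
        simp [hDz]
      · have hDx : D x ≠ 0 := hx hxz
        have hxz' : x - z ≠ 0 := sub_ne_zero.2 hxz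
        simp only [hDx, if_false, Pi.div_apply, dslope_of_ne _ hxz, slope_def_field, hFz, hDz,
          sub_zero]
        field_simp
  · by_cases h0 : D z = 0
    · obtain ⟨k, hk⟩ := exists_zpow_of_ellTheta_eq_zero hp0 hp1 (div_ne_zero hz hb) h0
      rw [(div_eq_iff hb).1 hk, h k, mul_div_cancel_right₀ _ hb, ellTheta_zpow hp0 hp1, zero_mul]
    · have : ellTheta (z / b) p ≠ 0 := h0
      simp only [h0, if_false]
      exact (mul_div_cancel₀ _ h0).symm

theorem zpow_mul_of_mul_left_eq (hp0 : p ≠ 0) {P : ℂ → Prop}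
    (h : ∀ z ≠ 0, P (p * z) ↔ P z) {z : ℂ} (hz : z ≠ 0) (k : ℤ) : P (p ^ k * z) ↔ P z := by
  induction k using Int.induction_on with
  | zero => simp
  | succ n ih =>
    rw [zpow_add_one₀ hp0, mul_comm (p ^ _) p, mul_assoc,
      h _ (mul_ne_zero (zpow_ne_zero _ hp0) hz), ih]
  | pred n ih =>
    rw [← ih, ← h _ (mul_ne_zero (zpow_ne_zero _ hp0) hz), ← mul_assoc, ← zpow_one_add₀ hp0,
      show (1 : ℤ) + (-(n : ℤ) - 1) = -n by ring]

/-- A holomorphic function on the punctured plane with `H (p z) = H z` is constant. -/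
theorem eq_of_mul_left_periodic (hp0 : p ≠ 0) (hp1 : ‖p‖ < 1) {H : ℂ → ℂ}
    (hH : ∀ z ≠ 0, DifferentiableAt ℂ H z) (hper : ∀ z ≠ 0, H (p * z) = H z)
    {z w : ℂ} (hz : z ≠ 0) (hw : w ≠ 0) : H z = H w := by
  have hp : 0 < ‖p‖ := norm_pos_iff.2 hp0
  have hK : IsCompact (Metric.closedBall (0 : ℂ) 1 \ Metric.ball 0 ‖p‖) :=
    (isCompact_closedBall _ _).diff Metric.isOpen_ball
  have hK0 : ∀ x ∈ Metric.closedBall (0 : ℂ) 1 \ Metric.ball 0 ‖p‖, x ≠ 0 := by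
    rintro x ⟨-, hx⟩ rfl
    exact hx (by simpa using hp0)
  obtain ⟨C, hC⟩ := hK.exists_bound_of_continuousOn (f := H)
    fun x hx => (hH x (hK0 x hx)).continuousAt.continuousWithinAt
  have hbd : ∀ x ≠ 0, ‖H x‖ ≤ C := by
    intro x hx
    obtain ⟨n, hn1, hn2⟩ := exists_mem_Ico_zpow (norm_pos_iff.2 hx) ((one_lt_inv₀ hp).2 hp1)
    have key := (zpow_mul_of_mul_left_eq hp0 (P := fun y => H y = H x)
      (fun y hy => by rw [hper y hy]) hx (n + 1)).2 rfl
    rw [← key]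
    have hpn : 0 < ‖p‖ ^ (n + 1) := zpow_pos hp _
    refine hC _ ⟨?_, ?_⟩
    · rw [mem_closedBall_zero_iff, norm_mul, norm_zpow]
      calc ‖p‖ ^ (n + 1) * ‖x‖ ≤ ‖p‖ ^ (n + 1) * (‖p‖⁻¹) ^ (n + 1) := by gcongr
        _ = 1 := by rw [inv_zpow, mul_inv_cancel₀ hpn.ne']
    · rw [mem_ball_zero_iff, not_lt, norm_mul, norm_zpow]
      calc ‖p‖ = ‖p‖ ^ (n + 1) * (‖p‖⁻¹) ^ n := by
            rw [inv_zpow, zpow_add_one₀ hp.ne']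
            field_simp
        _ ≤ ‖p‖ ^ (n + 1) * ‖x‖ := by gcongr
  have hd : Differentiable ℂ fun u => H (Complex.exp u) := fun u =>
    DifferentiableAt.comp (g := H) u (hH _ (Complex.exp_ne_zero u)) Complex.differentiableAt_exp
  have hb : Bornology.IsBounded (Set.range fun u => H (Complex.exp u)) := by
    refine isBounded_iff_forall_norm_le.2 ⟨C, ?_⟩
    rintro _ ⟨u, rfl⟩
    exact hbd _ (Complex.exp_ne_zero u)
  have := hd.apply_eq_apply_of_bounded hb (Complex.log z) (Complex.log w)
  simpa [Complex.exp_log hz, Complex.exp_log hw] using this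

/-- A theta function of degree `N` with `N + 1` inequivalent zeros vanishes identically. -/
theorem eq_zero_of_quasiPeriodic (hp0 : p ≠ 0) (hp1 : ‖p‖ < 1) (bs : List ℂ) :
    ∀ (F : ℂ → ℂ) (c : ℂ), c ≠ 0 → (∀ z ≠ 0, DifferentiableAt ℂ F z) →
      (∀ z ≠ 0, F (p * z) = c * z ^ (1 - (bs.length : ℤ)) * F z) →
      (∀ b ∈ bs, b ≠ 0) → (∀ b ∈ bs, F b = 0) →
      bs.Pairwise (fun b b' => ellTheta (b / b') p ≠ 0) → ∀ z ≠ 0, F z = 0 := by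
  induction bs with
  | nil =>
    intro F c hc hF hper _ _ _ z hz
    have hb : (-c)⁻¹ ≠ 0 := inv_ne_zero (neg_ne_zero.2 hc)
    have hH : ∀ z ≠ 0, DifferentiableAt ℂ (fun x => ellTheta (x / (-c)⁻¹) p * F x) z :=
      fun z hz => (differentiableAt_ellTheta_div hp1 hb hz).mul (hF z hz)
    have hHper : ∀ z ≠ 0, ellTheta (p * z / (-c)⁻¹) p * F (p * z) =
        ellTheta (z / (-c)⁻¹) p * F z := by
      intro z hz
      rw [mul_div_assoc, ellTheta_mul_left hp0 hp1 (div_ne_zero hz hb), hper z hz]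
      simp only [List.length_nil, Nat.cast_zero, sub_zero, zpow_one]
      field_simp
    refine eq_of_ellTheta_div_mul_eq hp0 hp1 hb (G := fun _ => 0) hF (by fun_prop) ?_ hz
    intro w hw
    rw [eq_of_mul_left_periodic hp0 hp1 hH hHper hw hb, div_self hb, ellTheta_one hp1]
    simp
  | cons b bs ih =>
    intro F c hc hF hper hb0 hFb hpw z hz
    have hb : b ≠ 0 := hb0 b (by simp)
    obtain ⟨G, hG, hFG⟩ := exists_eq_ellTheta_div_mul hp0 hp1 hb hF fun k =>
      (zpow_mul_of_mul_left_eq hp0 (P := fun y => F y = 0) (fun y hy => by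
        rw [hper y hy, mul_eq_zero, or_iff_right (mul_ne_zero hc (zpow_ne_zero _ hy))]) hb k).2
          (hFb b (by simp))
    rw [hFG z hz, ih G (-c / b) (div_ne_zero (neg_ne_zero.2 hc) hb) hG ?_
      (fun x hx => hb0 x (by simp [hx])) ?_ (List.pairwise_cons.1 hpw).2 z hz, mul_zero]
    · intro w hw
      refine eq_of_ellTheta_div_mul_eq hp0 hp1 hb (F := fun w => G (p * w))
        (G := fun w => -c / b * w ^ (1 - (bs.length : ℤ)) * G w) (fun x hx => ?_)
        (fun x hx => ?_) (fun x hx => ?_) hw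
      · exact DifferentiableAt.comp (g := G) x (hG _ (mul_ne_zero hp0 hx)) (by fun_prop)
      · exact ((differentiableAt_const _).mul (differentiableAt_zpow.2 (Or.inl hx))).mul (hG x hx)
      · have h1 := hper x hx
        rw [hFG _ (mul_ne_zero hp0 hx), hFG x hx, mul_div_assoc,
          ellTheta_mul_left hp0 hp1 (div_ne_zero hx hb)] at h1
        have h2 : x ^ (1 - (bs.length : ℤ)) = x ^ (1 - ((b :: bs).length : ℤ)) * x := by
          rw [← zpow_add_one₀ hx]
          congr 1
          simp
          ring
        rw [h2]
        field_simp at h1 ⊢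
        linear_combination -h1
    · intro x hx
      have hx0 : x ≠ 0 := hb0 x (by simp [hx])
      have h := hFb x (by simp [hx])
      rw [hFG x hx0] at h
      refine (mul_eq_zero.1 h).resolve_left ?_
      have := ellTheta_inv_ne_zero hp0 hp1 (div_ne_zero hb hx0) ((List.pairwise_cons.1 hpw).1 x hx)
      rwa [inv_div] at this

end QuasiPeriodic

/-! ### Sums over sign vectors -/

/-- `signSum s [x₁, …, xₘ] a` is the sum over `w₁ ∈ {x₁, x₁⁻¹}, …, wₘ ∈ {xₘ, xₘ⁻¹}` of
`∏ i, a wᵢ * ∏ i < j, s wᵢ wⱼ`. -/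
noncomputable def signSum (s : ℂ → ℂ → ℂ) : List ℂ → (ℂ → ℂ) → ℂ
  | [], _ => 1
  | x :: xs, a => a x * signSum s xs (fun v => a v * s x v) +
      a x⁻¹ * signSum s xs (fun v => a v * s x⁻¹ v)

section SignSum

variable {s : ℂ → ℂ → ℂ}

@[simp]
theorem signSum_nil (a : ℂ → ℂ) : signSum s [] a = 1 := rfl

theorem signSum_cons (x : ℂ) (xs : List ℂ) (a : ℂ → ℂ) :
    signSum s (x :: xs) a = a x * signSum s xs (fun v => a v * s x v) +
      a x⁻¹ * signSum s xs (fun v => a v * s x⁻¹ v) := rfl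

theorem signSum_eq_prod_mul {xs : List ℂ} {a b : ℂ → ℂ} (h : ℂ → ℂ)
    (hab : ∀ x ∈ xs, a x = h x * b x ∧ a x⁻¹ = h x * b x⁻¹) :
    signSum s xs a = (xs.map h).prod * signSum s xs b := by
  induction xs generalizing a b with
  | nil => simp
  | cons x xs ih =>
    have ih' (u : ℂ) : signSum s xs (fun v => a v * s u v) =
        (xs.map h).prod * signSum s xs (fun v => b v * s u v) := ih fun v hv => by
      have := hab v (by simp [hv])
      exact ⟨by rw [this.1, mul_assoc], by rw [this.2, mul_assoc]⟩
    simp only [signSum_cons, ih', (hab x (by simp)).1, (hab x (by simp)).2, List.map_cons,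
      List.prod_cons]
    ring

theorem signSum_eq_pow_mul {xs : List ℂ} {a b : ℂ → ℂ} (c : ℂ)
    (hab : ∀ x ∈ xs, a x = c * b x ∧ a x⁻¹ = c * b x⁻¹) :
    signSum s xs a = c ^ xs.length * signSum s xs b := by
  rw [signSum_eq_prod_mul (fun _ => c) hab]
  simp

theorem signSum_congr {xs : List ℂ} {a b : ℂ → ℂ} (h : ∀ x ∈ xs, a x = b x ∧ a x⁻¹ = b x⁻¹) :
    signSum s xs a = signSum s xs b := by
  simpa using signSum_eq_pow_mul (s := s) (a := a) (b := b) 1 (by simpa using h)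

theorem signSum_inv_cons (x : ℂ) (xs : List ℂ) (a : ℂ → ℂ) :
    signSum s (x⁻¹ :: xs) a = signSum s (x :: xs) a := by
  rw [signSum_cons, signSum_cons, inv_inv, add_comm]

theorem signSum_perm (hs : ∀ u v, s u v = s v u) {xs ys : List ℂ} (h : xs.Perm ys)
    (a : ℂ → ℂ) : signSum s xs a = signSum s ys a := by
  induction h generalizing a with
  | nil => rfl
  | cons x _ ih => rw [signSum_cons, signSum_cons, ih, ih]
  | swap x y l =>
    have h (u w : ℂ) : signSum s l (fun v => a v * s u v * s w v) =
        signSum s l (fun v => a v * s w v * s u v) := by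
      congr! 2
      ring
    simp only [signSum_cons]
    rw [h y x, h y x⁻¹, h y⁻¹ x, h y⁻¹ x⁻¹, hs y x, hs y x⁻¹, hs y⁻¹ x, hs y⁻¹ x⁻¹]
    ring
  | trans _ _ ih₁ ih₂ => rw [ih₁, ih₂]

theorem differentiableAt_signSum {xs : List ℂ} {a : ℂ → ℂ → ℂ} {w : ℂ}
    (h : ∀ x ∈ xs, DifferentiableAt ℂ (a · x) w ∧ DifferentiableAt ℂ (a · x⁻¹) w) :
    DifferentiableAt ℂ (fun z => signSum s xs (a z)) w := by
  induction xs generalizing a with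
  | nil => simp
  | cons x xs ih =>
    simp only [signSum_cons]
    refine DifferentiableAt.add ((h x (by simp)).1.mul (ih fun v hv => ?_))
      ((h x (by simp)).2.mul (ih fun v hv => ?_)) <;>
    · have := h v (by simp [hv])
      exact ⟨this.1.mul_const _, this.2.mul_const _⟩

theorem continuousAt_signSum {xs : List ℂ} {s : ℂ → ℂ → ℂ → ℂ} {a : ℂ → ℂ → ℂ} {w : ℂ}
    (hs : ∀ x ∈ xs, ∀ y ∈ xs, ContinuousAt (s · x y) w ∧ ContinuousAt (s · x y⁻¹) w ∧
      ContinuousAt (s · x⁻¹ y) w ∧ ContinuousAt (s · x⁻¹ y⁻¹) w)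
    (h : ∀ x ∈ xs, ContinuousAt (a · x) w ∧ ContinuousAt (a · x⁻¹) w) :
    ContinuousAt (fun z => signSum (s z) xs (a z)) w := by
  induction xs generalizing a with
  | nil => exact continuousAt_const
  | cons x xs ih =>
    simp only [signSum_cons]
    have ih' := fun {a} => @ih a fun y hy z hz => hs y (by simp [hy]) z (by simp [hz])
    refine ContinuousAt.add ((h x (by simp)).1.mul (ih' fun v hv => ?_))
      ((h x (by simp)).2.mul (ih' fun v hv => ?_)) <;>
    · have h1 := h v (by simp [hv])
      have h2 := hs x (by simp) v (by simp [hv])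
      first
        | exact ⟨h1.1.mul h2.1, h1.2.mul h2.2.1⟩
        | exact ⟨h1.1.mul h2.2.2.1, h1.2.mul h2.2.2.2⟩

theorem sum_sign_eq_signSum {m : ℕ} (x : Fin m → ℂ) (a : ℂ → ℂ) :
    ∑ ε : Fin m → Bool, (∏ i, a (pw (x i) (ε i))) *
      ∏ i, ∏ j, (if i < j then s (pw (x i) (ε i)) (pw (x j) (ε j)) else 1) =
    signSum s (List.ofFn x) a := by
  induction m generalizing a with
  | zero => simp
  | succ m ih =>
    rw [List.ofFn_succ, signSum_cons, ← ih, ← ih,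
      ← (Fin.consEquiv fun _ : Fin (m + 1) => Bool).sum_comp, Fintype.sum_prod_type,
      Fintype.sum_bool, Finset.mul_sum, Finset.mul_sum]
    congr 1 <;>
    · refine Finset.sum_congr rfl fun ε _ => ?_
      simp only [Fin.consEquiv, Equiv.coe_fn_mk, Fin.prod_univ_succ, Fin.cons_zero, Fin.cons_succ,
        Fin.succ_lt_succ_iff, Fin.succ_pos, if_true, if_false, Fin.not_lt_zero,
        Finset.prod_mul_distrib, one_mul, pw, Bool.false_eq_true]
      ring

end SignSum

/-! ### Theta-function weights -/

theorem List.prod_map_eq_pow_mul {M : Type*} [CommMonoid M] {xs : List ℂ} {f g : ℂ → M} (c : M)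
    (h : ∀ x ∈ xs, f x = c * g x) : (xs.map f).prod = c ^ xs.length * (xs.map g).prod := by
  rw [List.map_congr_left h, List.prod_map_mul]
  simp

section Weights

/-- The interaction `θ(quv;p)/θ(uv;p)`. -/
noncomputable def crossRatio (q p u v : ℂ) : ℂ := ellTheta (q * (u * v)) p / ellTheta (u * v) p

/-- The product `∏_{y} θ(wy/σ;p) θ(w/(σy);p)`. -/
noncomputable def pairProd (σ p : ℂ) (ys : List ℂ) (w : ℂ) : ℂ :=
  (ys.map fun y => ellTheta (w * y / σ) p * ellTheta (w / (σ * y)) p).prod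

/-- The part of the weight that is holomorphic on the punctured plane. -/
noncomputable def weightNum (g : ℂ → ℂ) (σ p : ℂ) (ys : List ℂ) (w : ℂ) : ℂ :=
  g w * pairProd σ p ys w / w ^ (ys.length + 1)

/-- The one-variable weight of the sums over sign vectors. -/
noncomputable def thetaWeight (g : ℂ → ℂ) (σ p : ℂ) (ys : List ℂ) (w : ℂ) : ℂ :=
  weightNum g σ p ys w / ellTheta (w ^ 2) p

/-- The list consists of nonzero numbers for which the denominators of the sum do not vanish. -/
def ThetaGeneric (p : ℂ) (xs : List ℂ) : Prop :=
  (∀ x ∈ xs, x ≠ 0 ∧ ellTheta (x ^ 2) p ≠ 0) ∧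
    xs.Pairwise fun x y => ellTheta (x * y) p ≠ 0 ∧ ellTheta (x / y) p ≠ 0

/-- The common denominator of the sum as a function of its first variable. -/
noncomputable def poleProd (p : ℂ) (xs : List ℂ) (w : ℂ) : ℂ :=
  ellTheta (w ^ 2) p * (xs.map fun x => ellTheta (w * x) p * ellTheta (w / x) p).prod

/-- The terms of the sum in which the first variable is `w`, multiplied by `poleProd`. -/
noncomputable def clearedTerm (g : ℂ → ℂ) (σ p : ℂ) (xs ys : List ℂ) (w : ℂ) : ℂ :=
  weightNum g σ p ys w * signSum (crossRatio (σ ^ 2) p) xs (fun v =>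
    thetaWeight g σ p ys v * (ellTheta (σ ^ 2 * (w * v)) p * ellTheta (w / v) p))

variable {p σ : ℂ} {g : ℂ → ℂ} {xs ys : List ℂ}

theorem crossRatio_comm (q p u v : ℂ) : crossRatio q p u v = crossRatio q p v u := by
  simp only [crossRatio, mul_comm u v]

theorem ellTheta_div (hp0 : p ≠ 0) (hp1 : ‖p‖ < 1) {a b : ℂ} (ha : a ≠ 0) (hb : b ≠ 0) :
    ellTheta (a / b) p = -(a / b) * ellTheta (b / a) p := by
  rw [← inv_div b a, ellTheta_inv hp0 hp1 (div_ne_zero hb ha)]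

theorem ellTheta_div_ne_zero (hp0 : p ≠ 0) (hp1 : ‖p‖ < 1) {a b : ℂ} (ha : a ≠ 0) (hb : b ≠ 0)
    (h : ellTheta (a / b) p ≠ 0) : ellTheta (b / a) p ≠ 0 := by
  rw [← inv_div a b]
  exact ellTheta_inv_ne_zero hp0 hp1 (div_ne_zero ha hb) h

theorem ellTheta_p_mul_div (hp0 : p ≠ 0) (hp1 : ‖p‖ < 1) {a b : ℂ} (ha : a ≠ 0) (hb : b ≠ 0) :
    ellTheta (p * a / b) p = -(b / a) * ellTheta (a / b) p := by
  rw [mul_div_assoc, ellTheta_mul_left hp0 hp1 (div_ne_zero ha hb), inv_div]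

theorem ThetaGeneric.of_cons {x : ℂ} (h : ThetaGeneric p (x :: xs)) : ThetaGeneric p xs :=
  ⟨fun y hy => h.1 y (by simp [hy]), (List.pairwise_cons.1 h.2).2⟩

theorem thetaGeneric_cons {x : ℂ} : ThetaGeneric p (x :: xs) ↔
    (x ≠ 0 ∧ ellTheta (x ^ 2) p ≠ 0) ∧
    (∀ y ∈ xs, ellTheta (x * y) p ≠ 0 ∧ ellTheta (x / y) p ≠ 0) ∧ ThetaGeneric p xs := by
  simp only [ThetaGeneric, List.forall_mem_cons, List.pairwise_cons]
  tauto

theorem ThetaGeneric.perm (hp0 : p ≠ 0) (hp1 : ‖p‖ < 1) (h : ThetaGeneric p xs)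
    (hxy : xs.Perm ys) : ThetaGeneric p ys := by
  have h0 : ∀ y ∈ ys, y ≠ 0 ∧ ellTheta (y ^ 2) p ≠ 0 := fun y hy => h.1 y (hxy.mem_iff.2 hy)
  refine ⟨h0, ?_⟩
  have h1 : xs.Pairwise fun x y => (x ≠ 0 ∧ y ≠ 0) ∧
      ellTheta (x * y) p ≠ 0 ∧ ellTheta (x / y) p ≠ 0 :=
    h.2.imp_of_mem fun hx hy hh => ⟨⟨(h.1 _ hx).1, (h.1 _ hy).1⟩, hh⟩
  refine ((hxy.pairwise_iff fun hh => ?_).1 h1).imp fun hh => hh.2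
  exact ⟨hh.1.symm, by rw [mul_comm]; exact hh.2.1,
    ellTheta_div_ne_zero hp0 hp1 hh.1.1 hh.1.2 hh.2.2⟩

theorem poleProd_ne_zero {x : ℂ} (h : ThetaGeneric p (x :: xs)) : poleProd p xs x ≠ 0 := by
  rw [thetaGeneric_cons] at h
  refine mul_ne_zero h.1.2 (List.prod_ne_zero ?_)
  simp only [List.mem_map, not_exists, not_and, mul_eq_zero, not_or]
  exact fun y hy => h.2.1 y hy

theorem pairProd_perm {xs ys : List ℂ} (h : xs.Perm ys) (w : ℂ) :
    pairProd σ p xs w = pairProd σ p ys w :=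
  (h.map _).prod_eq

theorem pairProd_inv_cons (x : ℂ) (w : ℂ) :
    pairProd σ p (x⁻¹ :: xs) w = pairProd σ p (x :: xs) w := by
  have h1 : w * x⁻¹ / σ = w / (σ * x) := by
    rw [← div_eq_mul_inv, div_div, mul_comm]
  have h2 : w / (σ * x⁻¹) = w * x / σ := by
    rw [← div_eq_mul_inv, div_div_eq_mul_div]
  simp only [pairProd, List.map_cons, List.prod_cons, h1, h2]
  rw [mul_comm (ellTheta (w / (σ * x)) p)]

theorem thetaWeight_perm {xs ys : List ℂ} (h : xs.Perm ys) (w : ℂ) :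
    thetaWeight g σ p xs w = thetaWeight g σ p ys w := by
  simp only [thetaWeight, weightNum, pairProd_perm h, h.length_eq]

theorem thetaWeight_inv_cons (x : ℂ) (w : ℂ) :
    thetaWeight g σ p (x⁻¹ :: xs) w = thetaWeight g σ p (x :: xs) w := by
  simp only [thetaWeight, weightNum, pairProd_inv_cons, List.length_cons]

theorem poleProd_inv (hp0 : p ≠ 0) (hp1 : ‖p‖ < 1) (hxs : ∀ x ∈ xs, x ≠ 0) {w : ℂ}
    (hw : w ≠ 0) :
    poleProd p xs w⁻¹ = -(w ^ (2 * xs.length + 2))⁻¹ * poleProd p xs w := by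
  unfold poleProd
  rw [List.prod_map_eq_pow_mul (w ^ 2)⁻¹ (fun x hx => ?_), inv_pow, ellTheta_inv hp0 hp1
    (pow_ne_zero 2 hw)]
  · rw [inv_pow, ← pow_mul, pow_add, mul_inv]
    ring
  · have hx0 := hxs x hx
    have h1 : w⁻¹ * x = (w / x)⁻¹ := by field_simp
    have h2 : w⁻¹ / x = (w * x)⁻¹ := by field_simp
    rw [h1, h2, ellTheta_inv hp0 hp1 (div_ne_zero hw hx0), ellTheta_inv hp0 hp1
      (mul_ne_zero hw hx0)]
    field_simp

theorem poleProd_p_mul (hp0 : p ≠ 0) (hp1 : ‖p‖ < 1) (hxs : ∀ x ∈ xs, x ≠ 0) {w : ℂ}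
    (hw : w ≠ 0) :
    poleProd p xs (p * w) = (p * w ^ (2 * xs.length + 4))⁻¹ * poleProd p xs w := by
  unfold poleProd
  have h1 : (p * w) ^ 2 = p * (p * w ^ 2) := by ring
  rw [List.prod_map_eq_pow_mul (w ^ 2)⁻¹ (fun x hx => ?_), h1, ellTheta_mul_left hp0 hp1
    (mul_ne_zero hp0 (pow_ne_zero 2 hw)), ellTheta_mul_left hp0 hp1 (pow_ne_zero 2 hw)]
  · rw [inv_pow, ← pow_mul, pow_add]
    field_simp
  · have hx0 := hxs x hx
    rw [ellTheta_p_mul_div hp0 hp1 hw hx0, mul_assoc, ellTheta_mul_left hp0 hp1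
      (mul_ne_zero hw hx0)]
    field_simp

theorem pairProd_p_mul (hp0 : p ≠ 0) (hp1 : ‖p‖ < 1) (hσ : σ ≠ 0) (hys : ∀ y ∈ ys, y ≠ 0) {w : ℂ}
    (hw : w ≠ 0) :
    pairProd σ p ys (p * w) = (σ ^ 2 / w ^ 2) ^ ys.length * pairProd σ p ys w := by
  refine List.prod_map_eq_pow_mul _ fun y hy => ?_
  have hy0 := hys y hy
  rw [mul_assoc, ellTheta_p_mul_div hp0 hp1 (mul_ne_zero hw hy0) hσ,
    ellTheta_p_mul_div hp0 hp1 hw (mul_ne_zero hσ hy0)]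
  field_simp

theorem clearedTerm_perm {xs xs' : List ℂ} (h : xs.Perm xs') (w : ℂ) :
    clearedTerm g σ p xs ys w = clearedTerm g σ p xs' ys w := by
  unfold clearedTerm
  rw [signSum_perm (crossRatio_comm _ _) h]

/-- A summand of the sum in terms of the cleared one. -/
theorem thetaWeight_mul_signSum {w : ℂ} (h2 : ellTheta (w ^ 2) p ≠ 0)
    (h : ∀ x ∈ xs, ellTheta (w * x) p ≠ 0 ∧ ellTheta (w / x) p ≠ 0) :
    poleProd p xs w * (thetaWeight g σ p ys w * signSum (crossRatio (σ ^ 2) p) xs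
      (fun v => thetaWeight g σ p ys v * crossRatio (σ ^ 2) p w v)) =
    clearedTerm g σ p xs ys w := by
  have key := signSum_eq_prod_mul (s := crossRatio (σ ^ 2) p) (xs := xs)
    (a := fun v => thetaWeight g σ p ys v * (ellTheta (σ ^ 2 * (w * v)) p * ellTheta (w / v) p))
    (b := fun v => thetaWeight g σ p ys v * crossRatio (σ ^ 2) p w v)
    (fun x => ellTheta (w * x) p * ellTheta (w / x) p) (fun x hx => by
      obtain ⟨h1, h3⟩ := h x hx
      have e1 : w * x⁻¹ = w / x := (div_eq_mul_inv _ _).symm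
      have e2 : w / x⁻¹ = w * x := div_inv_eq_mul _ _
      simp only [crossRatio, e1, e2]
      constructor <;> field_simp)
  rw [clearedTerm, key, thetaWeight, poleProd]
  field_simp

end Weights

/-! ### Quasi-periodicity of the cleared sums -/

section Interpolation

variable {p σ : ℂ} {g g' : ℂ → ℂ} {xs ys : List ℂ}

theorem clearedTerm_p_mul (hp0 : p ≠ 0) (hp1 : ‖p‖ < 1) (hσ : σ ≠ 0) (hxs : ∀ x ∈ xs, x ≠ 0)
    (hys : ∀ y ∈ ys, y ≠ 0) {τ : ℂ} (hτ : τ ≠ 0)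
    (hg : ∀ z ≠ 0, g (p * z) = (τ * z ^ 4)⁻¹ * g z)
    (hbal : (σ ^ 2) ^ xs.length * τ = (σ ^ 2) ^ ys.length) {w : ℂ} (hw : w ≠ 0) :
    clearedTerm g σ p xs ys (p * w) =
      (p ^ (ys.length + 1) * w ^ (2 * ys.length + 2 * xs.length + 4))⁻¹ *
        clearedTerm g σ p xs ys w := by
  have key := signSum_eq_pow_mul (s := crossRatio (σ ^ 2) p) (xs := xs)
    (a := fun v => thetaWeight g σ p ys v *
      (ellTheta (σ ^ 2 * (p * w * v)) p * ellTheta (p * w / v) p))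
    (b := fun v => thetaWeight g σ p ys v *
      (ellTheta (σ ^ 2 * (w * v)) p * ellTheta (w / v) p)) (σ ^ 2 * w ^ 2)⁻¹ (fun x hx => by
      have aux (v : ℂ) (hv : v ≠ 0) : thetaWeight g σ p ys v *
          (ellTheta (σ ^ 2 * (p * w * v)) p * ellTheta (p * w / v) p) =
          (σ ^ 2 * w ^ 2)⁻¹ * (thetaWeight g σ p ys v *
            (ellTheta (σ ^ 2 * (w * v)) p * ellTheta (w / v) p)) := by
        have h1 : σ ^ 2 * (p * w * v) = p * (σ ^ 2 * (w * v)) := by ring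
        rw [h1, ellTheta_mul_left hp0 hp1 (by positivity), ellTheta_p_mul_div hp0 hp1 hw hv]
        field_simp
      exact ⟨aux _ (hxs x hx), aux _ (inv_ne_zero (hxs x hx))⟩)
  unfold clearedTerm
  have hs : (σ ^ 2) ^ xs.length ≠ 0 := by positivity
  rw [key, weightNum, weightNum, hg w hw, pairProd_p_mul hp0 hp1 hσ hys hw, mul_inv (σ ^ 2),
    mul_pow _ _ xs.length, div_pow, ← hbal]
  have e1 : w ^ (2 * ys.length + 2 * xs.length + 4) =
      (w ^ 2) ^ ys.length * (w ^ 2) ^ xs.length * w ^ 4 := by ring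
  rw [e1, mul_pow, inv_pow, inv_pow]
  have hw1 : (w ^ 2) ^ xs.length ≠ 0 := by positivity
  have hw2 : (w ^ 2) ^ ys.length ≠ 0 := by positivity
  have hw3 : w ^ (ys.length + 1) ≠ 0 := by positivity
  have hp3 : p ^ (ys.length + 1) ≠ 0 := by positivity
  field_simp

theorem clearedTerm_p_mul_inv (hp0 : p ≠ 0) (hp1 : ‖p‖ < 1) (hσ : σ ≠ 0) (hxs : ∀ x ∈ xs, x ≠ 0)
    (hys : ∀ y ∈ ys, y ≠ 0) {τ : ℂ} (hτ : τ ≠ 0)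
    (hg : ∀ z ≠ 0, g (p * z) = (τ * z ^ 4)⁻¹ * g z)
    (hbal : (σ ^ 2) ^ xs.length * τ = (σ ^ 2) ^ ys.length) {w : ℂ} (hw : w ≠ 0) :
    (p * w) ^ (2 * xs.length + 2) * clearedTerm g σ p xs ys (p * w)⁻¹ =
      (p ^ (ys.length + 1) * w ^ (2 * ys.length + 2 * xs.length + 4))⁻¹ *
        (w ^ (2 * xs.length + 2) * clearedTerm g σ p xs ys w⁻¹) := by
  have hpw : p * w ≠ 0 := mul_ne_zero hp0 hw
  have h := clearedTerm_p_mul hp0 hp1 hσ hxs hys hτ hg hbal (inv_ne_zero hpw)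
  have e : p * (p * w)⁻¹ = w⁻¹ := by field_simp
  rw [e] at h
  generalize clearedTerm g σ p xs ys (p * w)⁻¹ = X at h ⊢
  rw [h, inv_pow]
  have e1 : (p * w) ^ (2 * ys.length + 2 * xs.length + 4) =
      (p * w) ^ (2 * xs.length + 2) * (p ^ (ys.length + 1) * p ^ (ys.length + 1)) *
        w ^ (2 * ys.length + 2) := by ring
  have e2 : w ^ (2 * ys.length + 2 * xs.length + 4) =
      w ^ (2 * xs.length + 2) * w ^ (2 * ys.length + 2) := by ring
  rw [e1, e2]
  have h1 : (p * w) ^ (2 * xs.length + 2) ≠ 0 := by positivity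
  have h2 : w ^ (2 * ys.length + 2) ≠ 0 := by positivity
  have h3 : w ^ (2 * xs.length + 2) ≠ 0 := by positivity
  have h4 : p ^ (ys.length + 1) ≠ 0 := by positivity
  field_simp

/-- The residues at `w = x` of the terms with first variable `w` and `w⁻¹` cancel. -/
theorem clearedTerm_cons_self (hp0 : p ≠ 0) (hp1 : ‖p‖ < 1) {x : ℂ}
    (h : ThetaGeneric p (x :: xs)) :
    clearedTerm g σ p (x :: xs) ys x =
      x ^ (2 * (xs.length + 1) + 2) * clearedTerm g σ p (x :: xs) ys x⁻¹ := by
  obtain ⟨⟨hx, hx2⟩, hxx, hxs⟩ := thetaGeneric_cons.1 h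
  have hx2' : ellTheta (x⁻¹ ^ 2) p ≠ 0 := by
    rw [inv_pow]
    exact ellTheta_inv_ne_zero hp0 hp1 (pow_ne_zero 2 hx) hx2
  set Z := signSum (crossRatio (σ ^ 2) p) xs (fun v => thetaWeight g σ p ys v *
    (ellTheta (σ ^ 2 * (x * v)) p * ellTheta (σ ^ 2 * (x⁻¹ * v)) p / v)) with hZ
  have hne (v : ℂ) (hv : v ∈ xs) : v ≠ 0 ∧ v⁻¹ ≠ 0 ∧
      (ellTheta (x⁻¹ * v) p ≠ 0 ∧ ellTheta (x⁻¹ * v⁻¹) p ≠ 0) ∧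
      (ellTheta (x * v) p ≠ 0 ∧ ellTheta (x * v⁻¹) p ≠ 0) := by
    have hv0 := (hxs.1 v hv).1
    refine ⟨hv0, inv_ne_zero hv0, ⟨?_, ?_⟩, (hxx v hv).1, by
      rw [← div_eq_mul_inv]; exact (hxx v hv).2⟩
    · rw [mul_comm, ← div_eq_mul_inv]
      exact ellTheta_div_ne_zero hp0 hp1 hx hv0 (hxx v hv).2
    · rw [← mul_inv]
      exact ellTheta_inv_ne_zero hp0 hp1 (mul_ne_zero hx hv0) (hxx v hv).1
  have h1 := signSum_eq_pow_mul (s := crossRatio (σ ^ 2) p) (xs := xs)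
    (a := fun v => thetaWeight g σ p ys v * (ellTheta (σ ^ 2 * (x * v)) p * ellTheta (x / v) p) *
      crossRatio (σ ^ 2) p x⁻¹ v)
    (b := fun v => thetaWeight g σ p ys v *
      (ellTheta (σ ^ 2 * (x * v)) p * ellTheta (σ ^ 2 * (x⁻¹ * v)) p / v)) (-x) (fun v hv => by
      have aux (v : ℂ) (hv : v ≠ 0) (hxv : ellTheta (x⁻¹ * v) p ≠ 0) :
          thetaWeight g σ p ys v * (ellTheta (σ ^ 2 * (x * v)) p * ellTheta (x / v) p) *
            crossRatio (σ ^ 2) p x⁻¹ v = -x * (thetaWeight g σ p ys v *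
      (ellTheta (σ ^ 2 * (x * v)) p * ellTheta (σ ^ 2 * (x⁻¹ * v)) p / v)) := by
        rw [ellTheta_div hp0 hp1 hx hv, crossRatio, show v / x = x⁻¹ * v by ring]
        generalize ellTheta (x⁻¹ * v) p = A at hxv ⊢
        generalize ellTheta (σ ^ 2 * (x⁻¹ * v)) p = B
        field_simp
      obtain ⟨h0, h0', h1, -⟩ := hne v hv
      exact ⟨aux v h0 h1.1, aux v⁻¹ h0' h1.2⟩)
  have h2 := signSum_eq_pow_mul (s := crossRatio (σ ^ 2) p) (xs := xs)
    (a := fun v => thetaWeight g σ p ys v *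
      (ellTheta (σ ^ 2 * (x⁻¹ * v)) p * ellTheta (x⁻¹ / v) p) * crossRatio (σ ^ 2) p x v)
    (b := fun v => thetaWeight g σ p ys v *
      (ellTheta (σ ^ 2 * (x * v)) p * ellTheta (σ ^ 2 * (x⁻¹ * v)) p / v)) (-x⁻¹) (fun v hv => by
      have aux (v : ℂ) (hv : v ≠ 0) (hxv : ellTheta (x * v) p ≠ 0) :
          thetaWeight g σ p ys v * (ellTheta (σ ^ 2 * (x⁻¹ * v)) p * ellTheta (x⁻¹ / v) p) *
            crossRatio (σ ^ 2) p x v = -x⁻¹ * (thetaWeight g σ p ys v *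
      (ellTheta (σ ^ 2 * (x * v)) p * ellTheta (σ ^ 2 * (x⁻¹ * v)) p / v)) := by
        rw [ellTheta_div hp0 hp1 (inv_ne_zero hx) hv, crossRatio, div_inv_eq_mul, mul_comm v x]
        generalize ellTheta (x * v) p = A at hxv ⊢
        generalize ellTheta (σ ^ 2 * (x⁻¹ * v)) p = B
        field_simp
      obtain ⟨h0, h0', -, h1⟩ := hne v hv
      exact ⟨aux v h0 h1.1, aux v⁻¹ h0' h1.2⟩)
  unfold clearedTerm
  rw [signSum_cons, signSum_cons, h1, h2, ← hZ, div_self hx, div_self (inv_ne_zero hx),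
    ellTheta_one hp1, div_inv_eq_mul, mul_inv_cancel₀ hx, inv_mul_cancel₀ hx, thetaWeight,
    thetaWeight]
  have e1 : x⁻¹ / x = (x ^ 2)⁻¹ := by field_simp
  have e2 : x * x = x ^ 2 := by ring
  have e3 : x⁻¹ ^ 2 = (x ^ 2)⁻¹ := inv_pow _ _
  rw [e3] at hx2' ⊢
  rw [e1, e2, ellTheta_inv hp0 hp1 (pow_ne_zero 2 hx), neg_pow x, neg_pow x⁻¹, inv_pow]
  have e4 : x ^ (2 * (xs.length + 1) + 2) = x ^ xs.length * x ^ xs.length * x ^ 4 := by ring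
  rw [e4]
  field_simp
  ring

theorem signSum_thetaWeight_inv_cons (z : ℂ) :
    signSum (crossRatio (σ ^ 2) p) ys (thetaWeight g σ p (z⁻¹ :: xs)) =
      signSum (crossRatio (σ ^ 2) p) ys (thetaWeight g σ p (z :: xs)) := by
  congr 1
  exact funext fun v => thetaWeight_inv_cons z v

theorem signSum_thetaWeight_p_mul_cons (hp0 : p ≠ 0) (hp1 : ‖p‖ < 1) (hσ : σ ≠ 0)
    (hys : ∀ y ∈ ys, y ≠ 0) {z : ℂ} (hz : z ≠ 0) :
    signSum (crossRatio (σ ^ 2) p) ys (thetaWeight g σ p (p * z :: xs)) =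
      ((p * z ^ 2)⁻¹) ^ ys.length *
        signSum (crossRatio (σ ^ 2) p) ys (thetaWeight g σ p (z :: xs)) := by
  refine signSum_eq_pow_mul _ fun y hy => ?_
  have aux (v : ℂ) (hv : v ≠ 0) : thetaWeight g σ p (p * z :: xs) v =
      (p * z ^ 2)⁻¹ * thetaWeight g σ p (z :: xs) v := by
    have h1 : v * (p * z) / σ = p * (v * z) / σ := by ring
    have h2 := ellTheta_p_mul_div hp0 hp1 hv
      (mul_ne_zero hσ (mul_ne_zero hp0 hz))
    have h3 : p * v / (σ * (p * z)) = v / (σ * z) := by field_simp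
    rw [h3] at h2
    simp only [thetaWeight, weightNum, pairProd, List.map_cons, List.prod_cons, List.length_cons]
    rw [h1, h2, ellTheta_p_mul_div hp0 hp1 (mul_ne_zero hv hz) hσ]
    field_simp
  exact ⟨aux _ (hys y hy), aux _ (inv_ne_zero (hys y hy))⟩

theorem differentiableAt_list_prod {ι : Type*} (l : List ι) {f : ι → ℂ → ℂ} {w : ℂ}
    (h : ∀ i ∈ l, DifferentiableAt ℂ (f i) w) :
    DifferentiableAt ℂ (fun z => (l.map fun i => f i z).prod) w := by
  induction l with
  | nil => simp
  | cons i l ih =>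
    simp only [List.map_cons, List.prod_cons]
    exact (h i (by simp)).mul (ih fun j hj => h j (by simp [hj]))

theorem DifferentiableAt.ellTheta {f : ℂ → ℂ} {w : ℂ} (hf : DifferentiableAt ℂ f w)
    (hp1 : ‖p‖ < 1) (h0 : f w ≠ 0) : DifferentiableAt ℂ (fun z => ellTheta (f z) p) w :=
  DifferentiableAt.comp (g := fun x => _root_.ellTheta x p) w (differentiableAt_ellTheta hp1 h0) hf

theorem differentiableAt_clearedTerm (hp1 : ‖p‖ < 1) (hσ : σ ≠ 0) (hxs : ∀ x ∈ xs, x ≠ 0)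
    (hys : ∀ y ∈ ys, y ≠ 0) (hg : ∀ z ≠ 0, DifferentiableAt ℂ g z) {w : ℂ} (hw : w ≠ 0) :
    DifferentiableAt ℂ (clearedTerm g σ p xs ys) w := by
  refine DifferentiableAt.mul (DifferentiableAt.fun_div ((hg w hw).mul ?_) (by fun_prop)
    (by positivity)) (differentiableAt_signSum fun x hx => ?_)
  · refine differentiableAt_list_prod _ fun y hy => ?_
    have hy0 := hys y hy
    exact (DifferentiableAt.ellTheta (by fun_prop) hp1 (by positivity)).mul
      (DifferentiableAt.ellTheta (by fun_prop) hp1 (by positivity))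
  · have hx0 := hxs x hx
    constructor <;>
    exact DifferentiableAt.const_mul
      ((DifferentiableAt.ellTheta (by fun_prop) hp1 (by positivity)).mul
      (DifferentiableAt.ellTheta (by fun_prop) hp1 (by positivity))) _

theorem differentiableAt_poleProd (hp1 : ‖p‖ < 1) (hxs : ∀ x ∈ xs, x ≠ 0) {w : ℂ} (hw : w ≠ 0) :
    DifferentiableAt ℂ (poleProd p xs) w := by
  refine DifferentiableAt.mul (DifferentiableAt.ellTheta (by fun_prop) hp1 (by positivity))
    (differentiableAt_list_prod _ fun x hx => ?_)
  have hx0 := hxs x hx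
  exact (DifferentiableAt.ellTheta (by fun_prop) hp1 (by positivity)).mul
      (DifferentiableAt.ellTheta (by fun_prop) hp1 (by positivity))

theorem differentiableAt_signSum_thetaWeight_cons (hp1 : ‖p‖ < 1) (hσ : σ ≠ 0)
    (hys : ∀ y ∈ ys, y ≠ 0) {w : ℂ} (hw : w ≠ 0) :
    DifferentiableAt ℂ (fun z => signSum (crossRatio (σ ^ 2) p) ys
      (thetaWeight g σ p (z :: xs))) w := by
  refine differentiableAt_signSum fun y hy => ?_
  have hy0 := hys y hy
  simp only [thetaWeight, weightNum, pairProd, List.map_cons, List.prod_cons, List.length_cons]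
  constructor <;>
  exact DifferentiableAt.div_const (DifferentiableAt.div_const (DifferentiableAt.const_mul
    (((DifferentiableAt.ellTheta (by fun_prop) hp1 (by positivity)).mul
      (DifferentiableAt.ellTheta (by fun_prop (disch := positivity)) hp1
        (by positivity))).mul_const _) _) _) _

end Interpolation

/-! ### Interpolation in the first variable -/

section HalfPeriods

variable {p : ℂ}

theorem zpow_injective_of_norm_lt_one (hp0 : p ≠ 0) (hp1 : ‖p‖ < 1) {i j : ℤ}
    (h : p ^ i = p ^ j) : i = j := by
  have h' := congrArg norm h
  rw [norm_zpow, norm_zpow] at h'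
  exact zpow_right_injective₀ (norm_pos_iff.2 hp0) hp1.ne h'

theorem ellTheta_neg_one_ne_zero (hp0 : p ≠ 0) (hp1 : ‖p‖ < 1) : ellTheta (-1) p ≠ 0 := by
  intro h
  obtain ⟨k, hk⟩ := exists_zpow_of_ellTheta_eq_zero hp0 hp1 (by norm_num) h
  have h2 : p ^ (k + k) = p ^ (0 : ℤ) := by rw [zpow_add₀ hp0, ← hk]; norm_num
  have h3 := zpow_injective_of_norm_lt_one hp0 hp1 h2
  obtain rfl : k = 0 := by omega
  norm_num at hk

theorem ellTheta_ne_zero_of_sq_mul (hp0 : p ≠ 0) (hp1 : ‖p‖ < 1) {u : ℂ} (h : p * u ^ 2 = 1) :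
    ellTheta u p ≠ 0 := by
  intro h0
  have hu : u ≠ 0 := by
    rintro rfl
    norm_num at h
  obtain ⟨k, rfl⟩ := exists_zpow_of_ellTheta_eq_zero hp0 hp1 hu h0
  have h2 : p ^ (1 + (k + k)) = p ^ (0 : ℤ) := by
    rw [zpow_add₀ hp0, zpow_add₀ hp0, zpow_one, ← sq, h, zpow_zero]
  have := zpow_injective_of_norm_lt_one hp0 hp1 h2
  omega

theorem ellTheta_div_ne_zero_of_sq_eq_zpow (hp0 : p ≠ 0) (hp1 : ‖p‖ < 1) {e x : ℂ} {j : ℤ}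
    (he : e ^ 2 = p ^ j) (hx : x ≠ 0) (hx2 : ellTheta (x ^ 2) p ≠ 0) : ellTheta (e / x) p ≠ 0 := by
  intro h0
  have he0 : e ≠ 0 := by
    rintro rfl
    exact zpow_ne_zero j hp0 (by simpa using he.symm)
  obtain ⟨k, hk⟩ := exists_zpow_of_ellTheta_eq_zero hp0 hp1 (div_ne_zero he0 hx) h0
  have hx' : x ^ 2 = p ^ (j - (k + k)) := by
    rw [zpow_sub₀ hp0, zpow_add₀ hp0, ← hk, ← he]
    field_simp
  exact hx2 (hx' ▸ ellTheta_zpow hp0 hp1 _)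

theorem pairwise_halfPeriods_append (hp0 : p ≠ 0) (hp1 : ‖p‖ < 1) {ρ : ℂ} (hρ : ρ ^ 2 = p)
    {cs : List ℂ} (h0 : ∀ c ∈ cs, c ≠ 0 ∧ ellTheta (c ^ 2) p ≠ 0)
    (h : cs.Pairwise fun c c' => ellTheta (c / c') p ≠ 0) :
    (([1, -1, ρ, -ρ] : List ℂ) ++ cs).Pairwise fun c c' => ellTheta (c / c') p ≠ 0 := by
  have hρ0 : ρ ≠ 0 := by
    rintro rfl
    exact hp0 (by simpa using hρ.symm)
  have h1 := ellTheta_neg_one_ne_zero hp0 hp1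
  refine List.pairwise_append.2 ⟨?_, h, fun e he c hc => ?_⟩
  · have h2 (a : ℂ) (ha : a ^ 2 = 1) : ellTheta (a / ρ) p ≠ 0 ∧ ellTheta (a / -ρ) p ≠ 0 := by
      constructor <;> refine ellTheta_ne_zero_of_sq_mul hp0 hp1 ?_ <;> field_simp <;>
        rw [ha, hρ, mul_one]
    have h3 : ρ / -ρ = -1 := by field_simp
    have h4 := h2 1 (by norm_num)
    have h5 := h2 (-1) (by norm_num)
    simp only [List.pairwise_cons, List.mem_cons, List.not_mem_nil, or_false, forall_eq_or_imp,
      forall_eq, h3]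
    simp [h1, h4, h5, -one_div]
  · obtain ⟨hc0, hc2⟩ := h0 c hc
    have : ∃ j : ℤ, e ^ 2 = p ^ j := by
      simp only [List.mem_cons, List.not_mem_nil, or_false] at he
      rcases he with rfl | rfl | rfl | rfl
      · exact ⟨0, by simp⟩
      · exact ⟨0, by simp⟩
      · exact ⟨1, by simpa using hρ⟩
      · exact ⟨1, by simpa using hρ⟩
    obtain ⟨j, hj⟩ := this
    exact ellTheta_div_ne_zero_of_sq_eq_zpow hp0 hp1 hj hc0 hc2

theorem ThetaGeneric.pairwise_append_inv_append (hp0 : p ≠ 0) (hp1 : ‖p‖ < 1) {xs zs : List ℂ}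
    (hxs : ThetaGeneric p xs) (hz : ∀ z ∈ zs, ThetaGeneric p (z :: xs))
    (hzs : zs.Pairwise fun z z' => ellTheta (z / z') p ≠ 0) :
    (xs ++ (xs.map (·⁻¹) ++ zs)).Pairwise fun c c' => ellTheta (c / c') p ≠ 0 := by
  have hxx : ∀ x ∈ xs, ∀ x' ∈ xs, ellTheta (x * x') p ≠ 0 := by
    have : Std.Symm fun x y => ellTheta (x * y) p ≠ 0 := ⟨fun a b h => by rwa [mul_comm]⟩
    refine fun x hx x' hx' => List.Pairwise.forall_of_forall
      (R := fun x y => ellTheta (x * y) p ≠ 0)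
      (fun a ha => ?_) (hxs.2.imp And.left) hx hx'
    rw [← sq]
    exact (hxs.1 a ha).2
  refine List.pairwise_append.2 ⟨hxs.2.imp And.right, List.pairwise_append.2 ⟨?_, hzs, ?_⟩, ?_⟩
  · rw [List.pairwise_map]
    refine hxs.2.imp_of_mem fun {a b} ha hb h => ?_
    rw [inv_div_inv]
    exact ellTheta_div_ne_zero hp0 hp1 (hxs.1 a ha).1 (hxs.1 b hb).1 h.2
  · intro a ha z hz'
    obtain ⟨x, hx, rfl⟩ := List.mem_map.1 ha
    have h := thetaGeneric_cons.1 (hz z hz')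
    rw [← inv_mul_eq_div, ← mul_inv]
    exact ellTheta_inv_ne_zero hp0 hp1 (mul_ne_zero h.1.1 (hxs.1 x hx).1) (h.2.1 x hx).1
  · intro x hx z hz'
    rcases List.mem_append.1 hz' with h | h
    · obtain ⟨x', hx', rfl⟩ := List.mem_map.1 h
      rw [div_inv_eq_mul]
      exact hxx x hx x' hx'
    · have h := thetaGeneric_cons.1 (hz z h)
      exact ellTheta_div_ne_zero hp0 hp1 h.1.1 (hxs.1 x hx).1 (h.2.1 x hx).2

end HalfPeriods

section Step

variable {p σ : ℂ} {g g' : ℂ → ℂ} {xs ys : List ℂ}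

/-- The difference of the two sides of the identity as a function of the first variable, multiplied
by the common denominator. -/
noncomputable def clearedDiff (g g' : ℂ → ℂ) (σ p C : ℂ) (xs ys : List ℂ) (z : ℂ) : ℂ :=
  clearedTerm g σ p xs ys z - z ^ (2 * xs.length + 2) * clearedTerm g σ p xs ys z⁻¹ -
    poleProd p xs z * (C * signSum (crossRatio (σ ^ 2) p) ys (thetaWeight g' σ p (z :: xs)))

theorem clearedDiff_eq (hp0 : p ≠ 0) (hp1 : ‖p‖ < 1) (C : ℂ) {z : ℂ}
    (hz : ThetaGeneric p (z :: xs)) :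
    clearedDiff g g' σ p C xs ys z = poleProd p xs z *
      (signSum (crossRatio (σ ^ 2) p) (z :: xs) (thetaWeight g σ p ys) -
        C * signSum (crossRatio (σ ^ 2) p) ys (thetaWeight g' σ p (z :: xs))) := by
  obtain ⟨⟨hz0, hz2⟩, hzx, hxs⟩ := thetaGeneric_cons.1 hz
  have hinv := poleProd_inv hp0 hp1 (fun x hx => (hxs.1 x hx).1) hz0
  unfold clearedDiff
  rw [← thetaWeight_mul_signSum hz2 hzx, ← thetaWeight_mul_signSum (w := z⁻¹), hinv, signSum_cons]
  · field_simp
    ring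
  · rw [inv_pow]
    exact ellTheta_inv_ne_zero hp0 hp1 (pow_ne_zero 2 hz0) hz2
  · intro x hx
    have hx0 := (hxs.1 x hx).1
    constructor
    · rw [inv_mul_eq_div]
      exact ellTheta_div_ne_zero hp0 hp1 hz0 hx0 (hzx x hx).2
    · rw [← inv_mul_eq_div, ← mul_inv, mul_comm]
      exact ellTheta_inv_ne_zero hp0 hp1 (mul_ne_zero hz0 hx0) (hzx x hx).1

theorem clearedDiff_inv (hp0 : p ≠ 0) (hp1 : ‖p‖ < 1) (C : ℂ) (hxs : ∀ x ∈ xs, x ≠ 0) {z : ℂ}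
    (hz : z ≠ 0) :
    clearedDiff g g' σ p C xs ys z⁻¹ =
      -(z ^ (2 * xs.length + 2))⁻¹ * clearedDiff g g' σ p C xs ys z := by
  unfold clearedDiff
  rw [poleProd_inv hp0 hp1 hxs hz, signSum_thetaWeight_inv_cons, inv_inv, inv_pow]
  field_simp
  ring

theorem clearedDiff_p_mul (hp0 : p ≠ 0) (hp1 : ‖p‖ < 1) (hσ : σ ≠ 0) (C : ℂ)
    (hxs : ∀ x ∈ xs, x ≠ 0) (hys : ∀ y ∈ ys, y ≠ 0) {τ : ℂ} (hτ : τ ≠ 0)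
    (hg : ∀ z ≠ 0, g (p * z) = (τ * z ^ 4)⁻¹ * g z)
    (hbal : (σ ^ 2) ^ xs.length * τ = (σ ^ 2) ^ ys.length) {z : ℂ} (hz : z ≠ 0) :
    clearedDiff g g' σ p C xs ys (p * z) =
      (p ^ (ys.length + 1) * z ^ (2 * ys.length + 2 * xs.length + 4))⁻¹ *
        clearedDiff g g' σ p C xs ys z := by
  unfold clearedDiff
  rw [clearedTerm_p_mul hp0 hp1 hσ hxs hys hτ hg hbal hz,
    clearedTerm_p_mul_inv hp0 hp1 hσ hxs hys hτ hg hbal hz, poleProd_p_mul hp0 hp1 hxs hz,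
    signSum_thetaWeight_p_mul_cons hp0 hp1 hσ hys hz]
  have e1 : p ^ (ys.length + 1) * z ^ (2 * ys.length + 2 * xs.length + 4) =
      (p * z ^ 2) ^ ys.length * (p * z ^ (2 * xs.length + 4)) := by ring
  rw [e1, mul_inv, inv_pow]
  ring

theorem clearedDiff_eq_zero_of_mem (hp0 : p ≠ 0) (hp1 : ‖p‖ < 1) (C : ℂ)
    (hxs : ThetaGeneric p xs) {x : ℂ} (hx : x ∈ xs) : clearedDiff g g' σ p C xs ys x = 0 := by
  have hperm := List.perm_cons_erase hx
  have hx0 := (hxs.1 x hx).1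
  have hlen : xs.length = (xs.erase x).length + 1 := by simpa using hperm.length_eq
  have h0 : poleProd p xs x = 0 := by
    refine mul_eq_zero_of_right _ (List.prod_eq_zero (List.mem_map.2 ⟨x, hx, ?_⟩))
    rw [div_self hx0, ellTheta_one hp1, mul_zero]
  rw [clearedDiff, h0, clearedTerm_perm hperm, clearedTerm_perm hperm,
    clearedTerm_cons_self hp0 hp1 (hxs.perm hp0 hp1 hperm), hlen]
  ring

theorem clearedDiff_eq_zero_of_sq_eq_one (hp1 : ‖p‖ < 1) (C : ℂ) {e : ℂ} (he : e ^ 2 = 1) :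
    clearedDiff g g' σ p C xs ys e = 0 := by
  have h1 : e⁻¹ = e := by
    rw [inv_eq_iff_eq_inv]
    exact eq_inv_of_mul_eq_one_left (by rw [← sq, he])
  have h2 : e ^ (2 * xs.length + 2) = 1 := by
    rw [← mul_add_one, pow_mul, he, one_pow]
  rw [clearedDiff, h1, h2, poleProd, he, ellTheta_one hp1]
  ring

theorem clearedDiff_eq_zero_of_sq_eq (hp0 : p ≠ 0) (hp1 : ‖p‖ < 1) (hσ : σ ≠ 0) (C : ℂ)
    (hxs : ∀ x ∈ xs, x ≠ 0) (hys : ∀ y ∈ ys, y ≠ 0) {τ : ℂ} (hτ : τ ≠ 0)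
    (hg : ∀ z ≠ 0, g (p * z) = (τ * z ^ 4)⁻¹ * g z)
    (hbal : (σ ^ 2) ^ xs.length * τ = (σ ^ 2) ^ ys.length) {e : ℂ} (he : e ^ 2 = p) :
    clearedDiff g g' σ p C xs ys e = 0 := by
  have he0 : e ≠ 0 := by
    rintro rfl
    exact hp0 (by simpa using he.symm)
  have h1 : p * e⁻¹ = e := by rw [← he]; field_simp
  have h2 := clearedDiff_p_mul (g' := g') hp0 hp1 hσ C hxs hys hτ hg hbal (inv_ne_zero he0)
  have h3 : p ^ (ys.length + 1) * e⁻¹ ^ (2 * ys.length + 2 * xs.length + 4) =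
      (e ^ (2 * xs.length + 2))⁻¹ := by
    rw [← he, inv_pow]
    field_simp
    ring
  rw [h1, h3, inv_inv, clearedDiff_inv hp0 hp1 C hxs he0] at h2
  have h4 : e ^ (2 * xs.length + 2) ≠ 0 := pow_ne_zero _ he0
  rw [neg_mul, mul_neg, mul_inv_cancel_left₀ h4] at h2
  exact self_eq_neg.1 h2

/-- The identity holds for every first variable once it holds for `2 l + 1` of them. -/
theorem signSum_cons_eq_of_interpolation (hp0 : p ≠ 0) (hp1 : ‖p‖ < 1) (hσ : σ ≠ 0) (C : ℂ)
    (hxs : ThetaGeneric p xs) (hys : ∀ y ∈ ys, y ≠ 0) {τ : ℂ} (hτ : τ ≠ 0)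
    (hgd : ∀ z ≠ 0, DifferentiableAt ℂ g z)
    (hg : ∀ z ≠ 0, g (p * z) = (τ * z ^ 4)⁻¹ * g z)
    (hbal : (σ ^ 2) ^ xs.length * τ = (σ ^ 2) ^ ys.length) {zs : List ℂ}
    (hlen : zs.length = 2 * ys.length + 1) (hz : ∀ z ∈ zs, ThetaGeneric p (z :: xs))
    (hzs : zs.Pairwise fun z z' => ellTheta (z / z') p ≠ 0)
    (heq : ∀ z ∈ zs, signSum (crossRatio (σ ^ 2) p) (z :: xs) (thetaWeight g σ p ys) =
      C * signSum (crossRatio (σ ^ 2) p) ys (thetaWeight g' σ p (z :: xs)))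
    {x : ℂ} (hx : ThetaGeneric p (x :: xs)) :
    signSum (crossRatio (σ ^ 2) p) (x :: xs) (thetaWeight g σ p ys) =
      C * signSum (crossRatio (σ ^ 2) p) ys (thetaWeight g' σ p (x :: xs)) := by
  have hxs0 : ∀ x ∈ xs, x ≠ 0 := fun x hx => (hxs.1 x hx).1
  obtain ⟨ρ, hρ⟩ := IsAlgClosed.exists_pow_nat_eq p two_pos
  have hρ0 : ρ ≠ 0 := by
    rintro rfl
    exact hp0 (by simpa using hρ.symm)
  have hgen : ∀ c ∈ xs ++ (xs.map (·⁻¹) ++ zs), c ≠ 0 ∧ ellTheta (c ^ 2) p ≠ 0 := by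
    intro c hc
    simp only [List.mem_append, List.mem_map] at hc
    rcases hc with hc | ⟨x, hx, rfl⟩ | hc
    · exact hxs.1 c hc
    · obtain ⟨h0, h2⟩ := hxs.1 x hx
      refine ⟨inv_ne_zero h0, ?_⟩
      rw [inv_pow]
      exact ellTheta_inv_ne_zero hp0 hp1 (pow_ne_zero 2 h0) h2
    · exact (thetaGeneric_cons.1 (hz c hc)).1
  have key := eq_zero_of_quasiPeriodic hp0 hp1
    ([1, -1, ρ, -ρ] ++ (xs ++ (xs.map (·⁻¹) ++ zs))) (clearedDiff g g' σ p C xs ys)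
    (p ^ (ys.length + 1))⁻¹ (inv_ne_zero (pow_ne_zero _ hp0)) (fun z hz => ?_) (fun z hz => ?_)
    (fun b hb => ?_) (fun b hb => ?_)
    (pairwise_halfPeriods_append hp0 hp1 hρ hgen
      (hxs.pairwise_append_inv_append hp0 hp1 hz hzs))
    x (thetaGeneric_cons.1 hx).1.1
  · rw [clearedDiff_eq hp0 hp1 C hx] at key
    exact sub_eq_zero.1 ((mul_eq_zero.1 key).resolve_left (poleProd_ne_zero hx))
  · have h1 : DifferentiableAt ℂ (fun z => clearedTerm g σ p xs ys z⁻¹) z :=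
      DifferentiableAt.comp (g := clearedTerm g σ p xs ys) z
        (differentiableAt_clearedTerm hp1 hσ hxs0 hys hgd (inv_ne_zero hz))
        (differentiableAt_inv hz)
    exact ((differentiableAt_clearedTerm hp1 hσ hxs0 hys hgd hz).sub
      ((differentiableAt_pow _).mul h1)).sub ((differentiableAt_poleProd hp1 hxs0 hz).mul
      ((differentiableAt_signSum_thetaWeight_cons hp1 hσ hys hz).const_mul C))
  · have e : z ^ (1 - ((([1, -1, ρ, -ρ] ++ (xs ++ (xs.map (·⁻¹) ++ zs))).length : ℕ) : ℤ)) =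
        (z ^ (2 * ys.length + 2 * xs.length + 4))⁻¹ := by
      rw [← zpow_natCast, ← zpow_neg]
      congr 1
      simp only [List.length_append, List.length_cons, List.length_nil, List.length_map, hlen]
      push_cast
      ring
    rw [e, clearedDiff_p_mul hp0 hp1 hσ C hxs0 hys hτ hg hbal hz, mul_inv]
  · rcases List.mem_append.1 hb with hb | hb
    · simp only [List.mem_cons, List.not_mem_nil, or_false] at hb
      rcases hb with rfl | rfl | rfl | rfl <;> simp [hρ0]
    · exact (hgen b hb).1
  · simp only [List.mem_append, List.mem_map, List.mem_cons, List.not_mem_nil, or_false] at hb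
    rcases hb with (rfl | rfl | rfl | rfl) | hb | ⟨x, hx, rfl⟩ | hb
    · exact clearedDiff_eq_zero_of_sq_eq_one hp1 C (by norm_num)
    · exact clearedDiff_eq_zero_of_sq_eq_one hp1 C (by norm_num)
    · exact clearedDiff_eq_zero_of_sq_eq hp0 hp1 hσ C hxs0 hys hτ hg hbal hρ
    · exact clearedDiff_eq_zero_of_sq_eq hp0 hp1 hσ C hxs0 hys hτ hg hbal (by rw [neg_sq, hρ])
    · exact clearedDiff_eq_zero_of_mem hp0 hp1 C hxs hb
    · rw [clearedDiff_inv hp0 hp1 C hxs0 (hxs0 x hx),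
        clearedDiff_eq_zero_of_mem hp0 hp1 C hxs hx, mul_zero]
    · rw [clearedDiff_eq hp0 hp1 C (hz b hb), heq b hb, sub_self, mul_zero]

end Step

/-! ### The identity at special values of the first variable -/

section Evaluation

variable {p σ : ℂ} {xs ys : List ℂ}

/-- The product `∏_r θ(t_r w;p)`. -/
noncomputable def thetaQuad (p : ℂ) (t : Fin 4 → ℂ) (w : ℂ) : ℂ := ∏ r, ellTheta (t r * w) p

/-- The prefactor of the identity, with `d` factors and `m` variables on the left. -/
noncomputable def thetaCoeff (p σ : ℂ) (t : Fin 4 → ℂ) (m d : ℕ) : ℂ :=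
  ∏ i ∈ Finset.range d,
    ellTheta ((σ ^ 2) ^ i * (t 0 * t 1)) p * ellTheta ((σ ^ 2) ^ i * (t 0 * t 2)) p *
      ellTheta ((σ ^ 2) ^ i * (t 0 * t 3)) p / ((-σ) ^ ((m : ℤ) - 1) * t 0)

/-- The sum over sign vectors of the products of theta functions. -/
noncomputable def thetaSum (p σ : ℂ) (t : Fin 4 → ℂ) (xs ys : List ℂ) : ℂ :=
  signSum (crossRatio (σ ^ 2) p) xs (thetaWeight (thetaQuad p t) σ p ys)

/-- The transformation identity, relating the sum over the signs of `xs` to the one over the signs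
of `ys`. -/
def ThetaIdentity (p σ : ℂ) (t : Fin 4 → ℂ) (d : ℕ) (xs ys : List ℂ) : Prop :=
  thetaSum p σ t xs ys = thetaCoeff p σ t xs.length d * thetaSum p σ (fun r => σ / t r) ys xs

theorem thetaCoeff_eq_pow_mul (hσ : σ ≠ 0) (t : Fin 4 → ℂ) (m d : ℕ) :
    thetaCoeff p σ t m d = (-σ) ^ d * thetaCoeff p σ t (m + 1) d := by
  have h (a : ℂ) : a / ((-σ) ^ ((m : ℤ) - 1) * t 0) =
      -σ * (a / ((-σ) ^ (((m + 1 : ℕ) : ℤ) - 1) * t 0)) := by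
    have e : (-σ) ^ (((m + 1 : ℕ) : ℤ) - 1) = (-σ) ^ ((m : ℤ) - 1) * -σ := by
      rw [← zpow_add_one₀ (neg_ne_zero.2 hσ)]
      congr 1
      push_cast
      ring
    rw [e]
    field_simp
  simp only [thetaCoeff, h, Finset.prod_mul_distrib, Finset.prod_const, Finset.card_range]

theorem thetaQuad_p_mul (hp0 : p ≠ 0) (hp1 : ‖p‖ < 1) {t : Fin 4 → ℂ} (ht : ∀ r, t r ≠ 0) {z : ℂ}
    (hz : z ≠ 0) : thetaQuad p t (p * z) = ((∏ r, t r) * z ^ 4)⁻¹ * thetaQuad p t z := by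
  have h (r : Fin 4) : ellTheta (t r * (p * z)) p = -(t r * z)⁻¹ * ellTheta (t r * z) p := by
    rw [mul_left_comm, ellTheta_mul_left hp0 hp1 (mul_ne_zero (ht r) hz)]
  simp only [thetaQuad, h, Finset.prod_mul_distrib, Finset.prod_neg, Finset.prod_inv_distrib]
  simp only [Finset.prod_const, Finset.card_univ, Fintype.card_fin]
  ring

theorem thetaQuad_inv (hp0 : p ≠ 0) (hp1 : ‖p‖ < 1) (hσ : σ ≠ 0) {t : Fin 4 → ℂ}
    (ht : ∀ r, t r ≠ 0) {u : ℂ} (hu : u ≠ 0) :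
    thetaQuad p t (σ * u)⁻¹ = (∏ r, t r) / (σ * u) ^ 4 * thetaQuad p (fun r => σ / t r) u := by
  have h (r : Fin 4) : ellTheta (t r * (σ * u)⁻¹) p =
      -(t r / (σ * u)) * ellTheta (σ / t r * u) p := by
    rw [← div_eq_mul_inv, ellTheta_div hp0 hp1 (ht r) (mul_ne_zero hσ hu), div_mul_eq_mul_div]
  simp only [thetaQuad, h, Finset.prod_mul_distrib, Finset.prod_neg, Finset.prod_div_distrib]
  simp only [Finset.prod_const, Finset.card_univ, Fintype.card_fin]
  ring

theorem differentiableAt_thetaQuad (hp1 : ‖p‖ < 1) {t : Fin 4 → ℂ} (ht : ∀ r, t r ≠ 0) {z : ℂ}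
    (hz : z ≠ 0) : DifferentiableAt ℂ (thetaQuad p t) z :=
  DifferentiableAt.fun_finsetProd fun r _ =>
    DifferentiableAt.ellTheta (by fun_prop) hp1 (mul_ne_zero (ht r) hz)

theorem thetaWeight_cons_mul_crossRatio (g : ℂ → ℂ) (hσ : σ ≠ 0) {u v : ℂ} (hu : u ≠ 0)
    (hv : v ≠ 0) (h : ellTheta ((σ * u)⁻¹ * v) p ≠ 0) :
    thetaWeight g σ p (u :: ys) v * crossRatio (σ ^ 2) p (σ * u)⁻¹ v =
      ellTheta (v * u / σ) p * ellTheta (σ * v / u) p / v * thetaWeight g σ p ys v := by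
  have h1 : v / (σ * u) = (σ * u)⁻¹ * v := by ring
  have h2 : σ ^ 2 * ((σ * u)⁻¹ * v) = σ * v / u := by field_simp
  simp only [thetaWeight, weightNum, pairProd, crossRatio, List.map_cons, List.prod_cons,
    List.length_cons, h1, h2]
  generalize ellTheta ((σ * u)⁻¹ * v) p = A at h ⊢
  generalize ellTheta (v * u / σ) p = B
  generalize ellTheta (σ * v / u) p = D
  generalize (ys.map (β := ℂ) _).prod = P
  field_simp
  ring

theorem thetaWeight_mul_cons_mul_crossRatio (g : ℂ → ℂ) (hσ : σ ≠ 0) {u v : ℂ}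
    (hv : v ≠ 0) (h : ellTheta (u * v) p ≠ 0) :
    thetaWeight g σ p (σ * u :: xs) v * crossRatio (σ ^ 2) p u v =
      ellTheta (v / (σ ^ 2 * u)) p * ellTheta (σ ^ 2 * u * v) p / v *
        thetaWeight g σ p xs v := by
  have h1 : v * (σ * u) / σ = u * v := by field_simp
  have h2 : σ * (σ * u) = σ ^ 2 * u := by ring
  have h3 : σ ^ 2 * (u * v) = σ ^ 2 * u * v := by ring
  simp only [thetaWeight, weightNum, pairProd, crossRatio, List.map_cons, List.prod_cons,
    List.length_cons, h1, h2, h3]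
  generalize ellTheta (u * v) p = A at h ⊢
  generalize ellTheta (v / (σ ^ 2 * u)) p = B
  generalize ellTheta (σ ^ 2 * u * v) p = D
  generalize (xs.map (β := ℂ) _).prod = P
  field_simp
  ring

theorem ellTheta_mul_ellTheta_inv (hp0 : p ≠ 0) (hp1 : ‖p‖ < 1) {a b v : ℂ} (ha : a ≠ 0)
    (hab : a * b = 1) (hv : v ≠ 0) :
    ellTheta (a * v⁻¹) p * ellTheta (b * v⁻¹) p / v⁻¹ =
      ellTheta (a * v) p * ellTheta (b * v) p / v := by
  have hb : b = a⁻¹ := eq_inv_of_mul_eq_one_right hab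
  have h1 : a * v⁻¹ = (a⁻¹ * v)⁻¹ := by rw [mul_inv, inv_inv]
  have h2 : a⁻¹ * v⁻¹ = (a * v)⁻¹ := (mul_inv _ _).symm
  rw [hb, h1, h2, ellTheta_inv hp0 hp1 (mul_ne_zero (inv_ne_zero ha) hv),
    ellTheta_inv hp0 hp1 (mul_ne_zero ha hv)]
  generalize ellTheta (a * v) p = A
  generalize ellTheta (a⁻¹ * v) p = B
  field_simp

theorem signSum_special_left (hp0 : p ≠ 0) (hp1 : ‖p‖ < 1) (hσ : σ ≠ 0) (g : ℂ → ℂ) {u : ℂ}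
    (hx : ThetaGeneric p (σ * u :: xs)) (hu : u ≠ 0) :
    signSum (crossRatio (σ ^ 2) p) (σ * u :: xs) (thetaWeight g σ p (u :: ys)) =
      thetaWeight g σ p (u :: ys) (σ * u)⁻¹ * ((-(σ / u)) ^ xs.length * pairProd σ p xs u *
        signSum (crossRatio (σ ^ 2) p) xs (thetaWeight g σ p ys)) := by
  obtain ⟨⟨hu0, -⟩, hxx, hxs⟩ := thetaGeneric_cons.1 hx
  have h0 : thetaWeight g σ p (u :: ys) (σ * u) = 0 := by
    simp [thetaWeight, weightNum, pairProd, div_self hu0, ellTheta_one hp1]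
  have hk : (xs.map fun x => ellTheta (x * u / σ) p * ellTheta (σ * x / u) p / x).prod =
      (-(σ / u)) ^ xs.length * pairProd σ p xs u := by
    refine List.prod_map_eq_pow_mul _ fun x hx => ?_
    have hx0 := (hxs.1 x hx).1
    rw [ellTheta_div hp0 hp1 (mul_ne_zero hσ hx0) hu, mul_comm x u]
    generalize ellTheta (u * x / σ) p = A
    generalize ellTheta (u / (σ * x)) p = B
    field_simp
  rw [signSum_cons, h0, zero_mul, zero_add, signSum_eq_prod_mul
    (fun x => ellTheta (x * u / σ) p * ellTheta (σ * x / u) p / x) fun x hx => ?_, hk]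
  have hx0 := (hxs.1 x hx).1
  obtain ⟨h1, h2⟩ := hxx x hx
  refine ⟨thetaWeight_cons_mul_crossRatio g hσ hu hx0 ?_, ?_⟩
  · rw [inv_mul_eq_div]
    exact ellTheta_div_ne_zero hp0 hp1 hu0 hx0 h2
  · rw [thetaWeight_cons_mul_crossRatio g hσ hu (inv_ne_zero hx0)]
    · have h3 := ellTheta_mul_ellTheta_inv hp0 hp1 (div_ne_zero hu hσ)
        (div_mul_div_cancel₀ hσ |>.trans (div_self hu)) hx0
      have e (v : ℂ) : v * u / σ = u / σ * v := by ring
      have e' (v : ℂ) : σ * v / u = σ / u * v := by ring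
      rw [e, e, e', e', h3]
    · rw [← mul_inv]
      exact ellTheta_inv_ne_zero hp0 hp1 (mul_ne_zero hu0 hx0) h1

theorem signSum_special_right (hp0 : p ≠ 0) (hp1 : ‖p‖ < 1) (hσ : σ ≠ 0) (g : ℂ → ℂ) {u : ℂ}
    (hy : ThetaGeneric p (u :: ys)) :
    signSum (crossRatio (σ ^ 2) p) (u :: ys) (thetaWeight g σ p (σ * u :: xs)) =
      thetaWeight g σ p (σ * u :: xs) u *
        ((ys.map fun y => ellTheta (y / (σ ^ 2 * u)) p * ellTheta (σ ^ 2 * u * y) p / y).prod *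
        signSum (crossRatio (σ ^ 2) p) ys (thetaWeight g σ p xs)) := by
  obtain ⟨⟨hu, -⟩, hyy, hys⟩ := thetaGeneric_cons.1 hy
  have h0 : thetaWeight g σ p (σ * u :: xs) u⁻¹ = 0 := by
    have : u⁻¹ * (σ * u) / σ = 1 := by field_simp
    simp [thetaWeight, weightNum, pairProd, this, ellTheta_one hp1]
  rw [signSum_cons, h0, zero_mul, add_zero, signSum_eq_prod_mul
    (fun y => ellTheta (y / (σ ^ 2 * u)) p * ellTheta (σ ^ 2 * u * y) p / y) fun y hy => ?_]
  have hy0 := (hys.1 y hy).1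
  obtain ⟨h1, h2⟩ := hyy y hy
  refine ⟨thetaWeight_mul_cons_mul_crossRatio g hσ hy0 h1, ?_⟩
  rw [thetaWeight_mul_cons_mul_crossRatio g hσ (inv_ne_zero hy0) (by rwa [← div_eq_mul_inv])]
  have hq : σ ^ 2 * u ≠ 0 := mul_ne_zero (pow_ne_zero 2 hσ) hu
  have h3 := ellTheta_mul_ellTheta_inv hp0 hp1 (inv_ne_zero hq) (inv_mul_cancel₀ hq) hy0
  have e (v : ℂ) : v / (σ ^ 2 * u) = (σ ^ 2 * u)⁻¹ * v := by ring
  rw [e, e, h3]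

/-- At `x = σ u` with `u` one of the other variables, the identity reduces to the one with both
variables removed. -/
theorem thetaIdentity_special (hp0 : p ≠ 0) (hp1 : ‖p‖ < 1) (hσ : σ ≠ 0) {t : Fin 4 → ℂ}
    (ht : ∀ r, t r ≠ 0) {d : ℕ} (hd : xs.length = ys.length + d)
    (hbal : (σ ^ 2) ^ d * ∏ r, t r = σ ^ 2) {u : ℂ} (hx : ThetaGeneric p (σ * u :: xs))
    (hy : ThetaGeneric p (u :: ys)) (h : ThetaIdentity p σ t d xs ys) :
    ThetaIdentity p σ t d (σ * u :: xs) (u :: ys) := by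
  obtain ⟨⟨hu, hu2⟩, hyy, hys⟩ := thetaGeneric_cons.1 hy
  obtain ⟨⟨hσu, hσu2⟩, -, -⟩ := thetaGeneric_cons.1 hx
  have hl : thetaWeight (thetaQuad p t) σ p (u :: ys) (σ * u)⁻¹ =
      (∏ r, t r) / (σ * u) ^ 4 * thetaQuad p (fun r => σ / t r) u * ellTheta (σ ^ 2)⁻¹ p *
        ((-(σ ^ 2 * u)⁻¹) ^ ys.length * (ys.map fun y =>
          ellTheta (y / (σ ^ 2 * u)) p * ellTheta (σ ^ 2 * u * y) p / y).prod) *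
        (σ * u) ^ (ys.length + 2) := by
    have h1 : (σ * u)⁻¹ * u / σ = (σ ^ 2)⁻¹ := by field_simp
    have h2 : (σ * u)⁻¹ / (σ * u) = ((σ * u) ^ 2)⁻¹ := by field_simp
    have h3 : pairProd σ p ys (σ * u)⁻¹ = (-(σ ^ 2 * u)⁻¹) ^ ys.length * (ys.map fun y =>
        ellTheta (y / (σ ^ 2 * u)) p * ellTheta (σ ^ 2 * u * y) p / y).prod := by
      refine List.prod_map_eq_pow_mul _ fun y hy => ?_
      have hy0 := (hys.1 y hy).1
      have e1 : (σ * u)⁻¹ * y / σ = y / (σ ^ 2 * u) := by field_simp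
      have e2 : (σ * u)⁻¹ / (σ * y) = (σ ^ 2 * u * y)⁻¹ := by field_simp
      rw [e1, e2, ellTheta_inv hp0 hp1 (by positivity)]
      generalize ellTheta (σ ^ 2 * u * y) p = A
      generalize ellTheta (y / (σ ^ 2 * u)) p = B
      field_simp
    have h4 : pairProd σ p (u :: ys) (σ * u)⁻¹ = ellTheta (σ ^ 2)⁻¹ p *
        ellTheta ((σ * u) ^ 2)⁻¹ p * pairProd σ p ys (σ * u)⁻¹ := by
      simp only [pairProd, List.map_cons, List.prod_cons, h1, h2]
    have h5 := ellTheta_inv_ne_zero hp0 hp1 (pow_ne_zero 2 hσu) hσu2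
    rw [thetaWeight, weightNum, thetaQuad_inv hp0 hp1 hσ ht hu, h4, h3, List.length_cons,
      inv_pow (σ * u) 2]
    generalize ellTheta ((σ * u) ^ 2)⁻¹ p = A at h5 ⊢
    generalize (ys.map (β := ℂ) _).prod = B
    generalize ellTheta (σ ^ 2)⁻¹ p = D
    rw [inv_pow, div_inv_eq_mul]
    field_simp
  have hr : thetaWeight (thetaQuad p fun r => σ / t r) σ p (σ * u :: xs) u =
      thetaQuad p (fun r => σ / t r) u * ellTheta (σ ^ 2)⁻¹ p * pairProd σ p xs u /
        u ^ (xs.length + 2) := by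
    have h1 : u * (σ * u) / σ = u ^ 2 := by field_simp
    have h2 : u / (σ * (σ * u)) = (σ ^ 2)⁻¹ := by field_simp
    simp only [thetaWeight, weightNum, pairProd, List.map_cons, List.prod_cons, h1, h2,
      List.length_cons]
    generalize ellTheta (σ ^ 2)⁻¹ p = D
    field_simp
  have ht' : ∏ r, t r = σ ^ 2 / (σ ^ 2) ^ d :=
    eq_div_of_mul_eq (by positivity) ((mul_comm _ _).trans hbal)
  unfold ThetaIdentity thetaSum at h ⊢
  rw [signSum_special_left hp0 hp1 hσ _ hx hu, signSum_special_right hp0 hp1 hσ _ hy, h, hl, hr,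
    List.length_cons, thetaCoeff_eq_pow_mul hσ, ht', hd]
  generalize (ys.map (β := ℂ) _).prod = B
  generalize ellTheta (σ ^ 2)⁻¹ p = D
  generalize signSum _ _ _ = S
  generalize thetaQuad p _ u = Q
  generalize thetaCoeff p σ t _ d = C
  generalize pairProd σ p xs u = P
  generalize ys.length = l
  have e1 : -(σ / u) = -1 * (σ / u) := by ring
  have e2 : -(σ ^ 2 * u)⁻¹ = -1 * (σ ^ 2 * u)⁻¹ := by ring
  have e3 : -σ = -1 * σ := by ring
  rw [e1, e2, e3]
  simp only [mul_pow, div_pow, inv_pow, pow_add]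
  have hs : ((-1 : ℂ) ^ l * (-1) ^ l) = 1 := by rw [← mul_pow]; norm_num
  have hs' : ((-1 : ℂ) ^ d * (-1) ^ d) = 1 := by rw [← mul_pow]; norm_num
  field_simp
  generalize (-1 : ℂ) ^ l = a at hs ⊢
  generalize (-1 : ℂ) ^ d = b at hs' ⊢
  rw [sq a, hs, sq b, hs', pow_right_comm σ l 2, pow_right_comm σ d 2]
  ring

theorem thetaIdentity_special_nil (hp1 : ‖p‖ < 1) (hσ : σ ≠ 0) {t : Fin 4 → ℂ}
    (hx : ThetaGeneric p (t 0 :: xs))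
    (h : ThetaIdentity p σ (Function.update t 0 (σ ^ 2 * t 0)) xs.length xs []) :
    ThetaIdentity p σ t (xs.length + 1) (t 0 :: xs) [] := by
  obtain ⟨⟨h0, h2⟩, hxx, hxs⟩ := thetaGeneric_cons.1 hx
  have hz : thetaWeight (thetaQuad p t) σ p [] (t 0)⁻¹ = 0 := by
    simp [thetaWeight, weightNum, thetaQuad, Fin.prod_univ_four, mul_inv_cancel₀ h0,
      ellTheta_one hp1]
  have aux (v : ℂ) (hv : ellTheta (t 0 * v) p ≠ 0) :
      thetaWeight (thetaQuad p t) σ p [] v * crossRatio (σ ^ 2) p (t 0) v =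
        thetaWeight (thetaQuad p (Function.update t 0 (σ ^ 2 * t 0))) σ p [] v := by
    simp only [thetaWeight, weightNum, thetaQuad, Fin.prod_univ_four, crossRatio]
    simp only [Function.update_self, ne_eq, Fin.reduceEq, not_false_eq_true, Function.update_of_ne,
      mul_assoc (σ ^ 2) (t 0)]
    generalize ellTheta (t 0 * v) p = A at hv ⊢
    field_simp
  unfold ThetaIdentity thetaSum at h ⊢
  rw [signSum_cons, hz, zero_mul, add_zero, signSum_congr fun x hx =>
    ⟨aux x (hxx x hx).1, aux x⁻¹ (by rw [← div_eq_mul_inv]; exact (hxx x hx).2)⟩, h,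
    signSum_nil, signSum_nil]
  simp only [thetaCoeff, List.length_cons, Finset.prod_range_succ', thetaWeight, weightNum,
    thetaQuad, Fin.prod_univ_four, pairProd, Function.update_self, ne_eq, Fin.reduceEq,
    not_false_eq_true, Function.update_of_ne]
  have e1 : (-σ) ^ (((xs.length + 1 : ℕ) : ℤ) - 1) = (-σ) ^ ((xs.length : ℤ) - 1) * -σ := by
    rw [← zpow_add_one₀ (neg_ne_zero.2 hσ)]
    congr 1
    push_cast
    ring
  have e2 (i : ℕ) (r : Fin 4) : (σ ^ 2) ^ i * (σ ^ 2 * t 0 * t r) =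
      (σ ^ 2) ^ (i + 1) * (t 0 * t r) := by ring
  have e3 : (-σ) ^ ((xs.length : ℤ) - 1) * -σ = (-σ) ^ xs.length := by
    rw [← zpow_add_one₀ (neg_ne_zero.2 hσ), sub_add_cancel, zpow_natCast]
  have e4 (A : ℂ) : A / ((-σ) ^ ((xs.length : ℤ) - 1) * (σ ^ 2 * t 0)) =
      (-σ)⁻¹ * (A / ((-σ) ^ ((xs.length : ℤ) - 1) * -σ * t 0)) := by
    have := zpow_ne_zero ((xs.length : ℤ) - 1) (neg_ne_zero.2 hσ)
    field_simp
  simp only [e1, e2, e4, pow_zero, one_mul]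
  rw [Finset.prod_mul_distrib, Finset.prod_const, Finset.card_range]
  generalize ∏ i ∈ Finset.range xs.length, (_ : ℂ) = A
  rw [e3]
  have e5 : (-σ) ^ xs.length ≠ 0 := pow_ne_zero _ (neg_ne_zero.2 hσ)
  rw [← sq (t 0), inv_pow]
  simp
  field_simp

end Evaluation

/-! ### Induction on the number of variables -/

section Induction

open Filter Topology

variable {p σ : ℂ} {t : Fin 4 → ℂ} {d : ℕ} {xs ys : List ℂ}

theorem thetaIdentity_inv_cons_left (x : ℂ) :
    ThetaIdentity p σ t d (x⁻¹ :: xs) ys ↔ ThetaIdentity p σ t d (x :: xs) ys := by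
  simp only [ThetaIdentity, thetaSum, signSum_inv_cons, signSum_thetaWeight_inv_cons,
    List.length_cons]

theorem thetaIdentity_inv_cons_right (y : ℂ) :
    ThetaIdentity p σ t d xs (y⁻¹ :: ys) ↔ ThetaIdentity p σ t d xs (y :: ys) := by
  simp only [ThetaIdentity, thetaSum, signSum_inv_cons, signSum_thetaWeight_inv_cons]

theorem ThetaIdentity.perm_right {ys' : List ℂ} (h : ThetaIdentity p σ t d xs ys)
    (hy : ys.Perm ys') : ThetaIdentity p σ t d xs ys' := by
  have e (g : ℂ → ℂ) : thetaWeight g σ p ys' = thetaWeight g σ p ys :=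
    funext fun w => thetaWeight_perm hy.symm w
  unfold ThetaIdentity thetaSum at h ⊢
  rw [e, signSum_perm (fun u v => crossRatio_comm _ _ u v) hy.symm]
  exact h

theorem ThetaGeneric.inv_cons (hp0 : p ≠ 0) (hp1 : ‖p‖ < 1) {x : ℂ}
    (h : ThetaGeneric p (x :: xs)) : ThetaGeneric p (x⁻¹ :: xs) := by
  obtain ⟨⟨hx, hx2⟩, hxx, hxs⟩ := thetaGeneric_cons.1 h
  refine thetaGeneric_cons.2 ⟨⟨inv_ne_zero hx, ?_⟩, fun y hy => ⟨?_, ?_⟩, hxs⟩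
  · rw [inv_pow]
    exact ellTheta_inv_ne_zero hp0 hp1 (pow_ne_zero 2 hx) hx2
  · rw [inv_mul_eq_div]
    exact ellTheta_div_ne_zero hp0 hp1 hx (hxs.1 y hy).1 (hxx y hy).2
  · rw [div_eq_mul_inv, ← mul_inv]
    exact ellTheta_inv_ne_zero hp0 hp1 (mul_ne_zero hx (hxs.1 y hy).1) (hxx y hy).1

theorem thetaIdentity_cons_cons (hp0 : p ≠ 0) (hp1 : ‖p‖ < 1) (hσ : σ ≠ 0) (ht : ∀ r, t r ≠ 0)
    (hd : xs.length = ys.length + d) (hbal : (σ ^ 2) ^ d * ∏ r, t r = σ ^ 2) {x y : ℂ}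
    (hx : ThetaGeneric p (x :: xs)) (hy : ThetaGeneric p (y :: ys))
    (hu : ∀ u ∈ (y :: ys) ++ (y :: ys).map (·⁻¹),
      ThetaGeneric p (σ * u :: xs) ∧ ellTheta (σ ^ 2 * (u * y)) p ≠ 0)
    (ih : ∀ ys' : List ℂ, ys'.length = ys.length → ThetaGeneric p ys' →
      ThetaIdentity p σ t d xs ys') :
    ThetaIdentity p σ t d (x :: xs) (y :: ys) := by
  have key (u : ℂ) (hu' : u ∈ (y :: ys) ++ (y :: ys).map (·⁻¹)) :
      ThetaIdentity p σ t d (σ * u :: xs) (y :: ys) := by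
    have hσu := (hu u hu').1
    have aux (v : ℂ) (hv : v ∈ y :: ys) (w : ℂ) (hw : ThetaGeneric p (σ * w :: xs))
        (hwv : ThetaGeneric p (w :: (y :: ys).erase v)) :
        ThetaIdentity p σ t d (σ * w :: xs) (w :: (y :: ys).erase v) := by
      have hlen : ((y :: ys).erase v).length = ys.length := by
        rw [List.length_erase_of_mem hv, List.length_cons, Nat.add_sub_cancel]
      exact thetaIdentity_special hp0 hp1 hσ ht (hlen ▸ hd) hbal hw hwv
        (ih _ hlen hwv.of_cons)
    rcases List.mem_append.1 hu' with h | h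
    · have hp := List.perm_cons_erase h
      exact (aux u h u hσu (hy.perm hp0 hp1 hp)).perm_right hp.symm
    · obtain ⟨v, hv, rfl⟩ := List.mem_map.1 h
      have hp := List.perm_cons_erase hv
      exact ((thetaIdentity_inv_cons_right v).1 (aux v hv v⁻¹ hσu
        ((hy.perm hp0 hp1 hp).inv_cons hp0 hp1))).perm_right hp.symm
  have hpw := hy.pairwise_append_inv_append (zs := []) hp0 hp1 (by simp) List.Pairwise.nil
  rw [List.append_nil] at hpw
  have hmem : y ∈ (y :: ys) ++ (y :: ys).map (·⁻¹) := by simp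
  refine signSum_cons_eq_of_interpolation (τ := ∏ r, t r)
    (zs := ((y :: ys) ++ (y :: ys).map (·⁻¹)).map (σ * ·) ++ [(σ * y)⁻¹]) hp0 hp1 hσ _ hx.of_cons
    (fun y' hy' => (hy.1 y' hy').1) (Finset.prod_ne_zero_iff.2 fun r _ => ht r)
    (fun z hz => differentiableAt_thetaQuad hp1 ht hz)
    (fun z hz => thetaQuad_p_mul hp0 hp1 ht hz) ?_ ?_ ?_ ?_ ?_ hx
  · rw [hd, pow_add, mul_assoc, hbal, List.length_cons, pow_succ (σ ^ 2)]
  · simp only [List.length_append, List.length_map, List.length_cons, List.length_nil]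
    omega
  · intro z hz
    rcases List.mem_append.1 hz with h | h
    · obtain ⟨u, hu', rfl⟩ := List.mem_map.1 h
      exact (hu u hu').1
    · rw [List.mem_singleton.1 h]
      exact (hu y hmem).1.inv_cons hp0 hp1
  · refine List.pairwise_append.2 ⟨?_, List.pairwise_singleton _ _, ?_⟩
    · rw [List.pairwise_map]
      refine hpw.imp fun {a b} h => ?_
      rwa [mul_div_mul_left _ _ hσ]
    · intro a ha b hb
      obtain ⟨u, hu', rfl⟩ := List.mem_map.1 ha
      rw [List.mem_singleton.1 hb]
      have e : σ * u / (σ * y)⁻¹ = σ ^ 2 * (u * y) := by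
        rw [div_inv_eq_mul]
        ring
      rw [e]
      exact (hu u hu').2
  · intro z hz
    rcases List.mem_append.1 hz with h | h
    · obtain ⟨u, hu', rfl⟩ := List.mem_map.1 h
      exact key u hu'
    · rw [List.mem_singleton.1 h]
      exact (thetaIdentity_inv_cons_left _).2 (key y hmem)

theorem thetaIdentity_cons_nil (hp0 : p ≠ 0) (hp1 : ‖p‖ < 1) (hσ : σ ≠ 0) (ht : ∀ r, t r ≠ 0)
    (hbal : (σ ^ 2) ^ (xs.length + 1) * ∏ r, t r = σ ^ 2) {x : ℂ}
    (hx : ThetaGeneric p (x :: xs)) (hz : ThetaGeneric p (t 0 :: xs))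
    (ih : ThetaIdentity p σ (Function.update t 0 (σ ^ 2 * t 0)) xs.length xs []) :
    ThetaIdentity p σ t (xs.length + 1) (x :: xs) [] := by
  refine signSum_cons_eq_of_interpolation (τ := ∏ r, t r) (zs := [t 0]) hp0 hp1 hσ _ hx.of_cons
    (by simp) (Finset.prod_ne_zero_iff.2 fun r _ => ht r)
    (fun z hz => differentiableAt_thetaQuad hp1 ht hz)
    (fun z hz => thetaQuad_p_mul hp0 hp1 ht hz) ?_ rfl (by simpa using hz)
    (List.pairwise_singleton _ _) ?_ hx
  · refine mul_right_cancel₀ (pow_ne_zero 2 hσ) ?_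
    rw [List.length_nil]
    linear_combination hbal
  · intro z hz'
    rw [List.mem_singleton.1 hz']
    exact thetaIdentity_special_nil hp1 hσ hz ih

theorem eventually_ellTheta_mul_pow_ne_zero (hp0 : p ≠ 0) (hp1 : ‖p‖ < 1) {c : ℂ} (hc : c ≠ 0)
    {k : ℕ} (hk : k ≠ 0) : ∀ᶠ s : ℂ in 𝓝[≠] 1, ellTheta (c * s ^ k) p ≠ 0 := by
  have h1 : Tendsto (fun s : ℂ => s ^ k) (𝓝[≠] 1) (𝓝[≠] 1) := by
    simpa using (hasDerivAt_pow k (1 : ℂ)).tendsto_nhdsNE (by simpa using hk)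
  filter_upwards [h1.eventually
    (eventually_ellTheta_div_ne_zero hp0 hp1 (inv_ne_zero hc) one_ne_zero)] with s hs
  rwa [div_inv_eq_mul, mul_comm] at hs

theorem eventually_thetaGeneric_mul_cons (hp0 : p ≠ 0) (hp1 : ‖p‖ < 1) {c : ℂ} (hc : c ≠ 0)
    (h : ThetaGeneric p xs) : ∀ᶠ s : ℂ in 𝓝[≠] 1, ThetaGeneric p (c * s :: xs) := by
  have h0 : ∀ᶠ s : ℂ in 𝓝[≠] 1, s ≠ 0 :=
    mem_nhdsWithin_of_mem_nhds (isOpen_ne.mem_nhds one_ne_zero)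
  have h1 : ∀ᶠ s : ℂ in 𝓝[≠] 1, ∀ y ∈ {y | y ∈ xs},
      ellTheta (c * s * y) p ≠ 0 ∧ ellTheta (c * s / y) p ≠ 0 := by
    refine (eventually_all_finite (List.finite_toSet xs)).2 fun y hy => ?_
    have hy0 := (h.1 y hy).1
    filter_upwards [eventually_ellTheta_mul_pow_ne_zero hp0 hp1 (mul_ne_zero hc hy0) one_ne_zero,
      eventually_ellTheta_mul_pow_ne_zero hp0 hp1 (div_ne_zero hc hy0) one_ne_zero] with s h2 h3
    rw [pow_one] at h2 h3
    exact ⟨by rwa [mul_right_comm], by rwa [← div_mul_eq_mul_div]⟩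
  filter_upwards [h0, h1,
    eventually_ellTheta_mul_pow_ne_zero hp0 hp1 (pow_ne_zero 2 hc) two_ne_zero] with s h0 h1 h2
  exact thetaGeneric_cons.2 ⟨⟨mul_ne_zero hc h0, by rwa [mul_pow]⟩, h1, h⟩

theorem ContinuousAt.ellTheta {f : ℂ → ℂ} {w : ℂ} (hf : ContinuousAt f w) (hp1 : ‖p‖ < 1)
    (h0 : f w ≠ 0) : ContinuousAt (fun z => ellTheta (f z) p) w :=
  ContinuousAt.comp (g := fun x => _root_.ellTheta x p)
    (differentiableAt_ellTheta hp1 h0).continuousAt hf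

theorem ContinuousAt.list_prod_map {xs : List ℂ} {f : ℂ → ℂ → ℂ} {w : ℂ}
    (h : ∀ x ∈ xs, ContinuousAt (f · x) w) : ContinuousAt (fun z => (xs.map (f z)).prod) w := by
  induction xs with
  | nil => exact continuousAt_const
  | cons x xs ih =>
    simp only [List.map_cons, List.prod_cons]
    exact (h x (by simp)).mul (ih fun y hy => h y (by simp [hy]))

theorem continuousAt_thetaSum (hp1 : ‖p‖ < 1) {S : ℂ → ℂ} {T : ℂ → Fin 4 → ℂ} {w : ℂ}
    (hS : ContinuousAt S w) (hS0 : S w ≠ 0) (hT : ∀ r, ContinuousAt (T · r) w)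
    (hT0 : ∀ r, T w r ≠ 0) (hx : ∀ x ∈ xs, x ≠ 0) (hy : ∀ y ∈ ys, y ≠ 0) :
    ContinuousAt (fun z => thetaSum p (S z) (T z) xs ys) w := by
  have hc (u v : ℂ) (hu : u ≠ 0) (hv : v ≠ 0) :
      ContinuousAt (fun z => crossRatio (S z ^ 2) p u v) w :=
    (ContinuousAt.ellTheta ((hS.pow 2).mul_const _) hp1
      (mul_ne_zero (pow_ne_zero 2 hS0) (mul_ne_zero hu hv))).div_const _
  have ha (v : ℂ) (hv : v ≠ 0) :
      ContinuousAt (fun z => thetaWeight (thetaQuad p (T z)) (S z) p ys v) w := by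
    refine ContinuousAt.div_const (ContinuousAt.div_const (ContinuousAt.mul ?_ ?_) _) _
    · exact tendsto_finsetProd _ fun r _ =>
        ContinuousAt.ellTheta ((hT r).mul_const v) hp1 (mul_ne_zero (hT0 r) hv)
    · refine ContinuousAt.list_prod_map fun y hy' => ?_
      have hy0 := hy y hy'
      exact (ContinuousAt.ellTheta (continuousAt_const.div hS hS0) hp1
        (div_ne_zero (mul_ne_zero hv hy0) hS0)).mul
        (ContinuousAt.ellTheta (continuousAt_const.div (hS.mul_const y) (mul_ne_zero hS0 hy0)) hp1
          (div_ne_zero hv (mul_ne_zero hS0 hy0)))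
  refine continuousAt_signSum (fun x hx' y hy' => ?_) fun x hx' => ?_
  · have hx0 := hx x hx'
    have hy0 := hx y hy'
    exact ⟨hc _ _ hx0 hy0, hc _ _ hx0 (inv_ne_zero hy0), hc _ _ (inv_ne_zero hx0) hy0,
      hc _ _ (inv_ne_zero hx0) (inv_ne_zero hy0)⟩
  · exact ⟨ha _ (hx x hx'), ha _ (inv_ne_zero (hx x hx'))⟩

theorem continuousAt_thetaCoeff (hp1 : ‖p‖ < 1) {S : ℂ → ℂ} {T : ℂ → Fin 4 → ℂ} {w : ℂ}
    (hS : ContinuousAt S w) (hS0 : S w ≠ 0) (hT : ∀ r, ContinuousAt (T · r) w)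
    (hT0 : ∀ r, T w r ≠ 0) (m d : ℕ) :
    ContinuousAt (fun z => thetaCoeff p (S z) (T z) m d) w := by
  refine tendsto_finsetProd _ fun i _ => ?_
  have h (r : Fin 4) : ContinuousAt (fun z => ellTheta ((S z ^ 2) ^ i * (T z 0 * T z r)) p) w :=
    ContinuousAt.ellTheta (((hS.pow 2).pow i).mul ((hT 0).mul (hT r))) hp1
      (mul_ne_zero (by positivity) (mul_ne_zero (hT0 0) (hT0 r)))
  exact (((h 1).mul (h 2)).mul (h 3)).div
    ((hS.neg.zpow₀ _ (Or.inl (neg_ne_zero.2 hS0))).mul (hT 0))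
    (mul_ne_zero (zpow_ne_zero _ (neg_ne_zero.2 hS0)) (hT0 0))

/-- The parameters `t`, moved along a one-parameter family that preserves the balancing condition
when `σ` is replaced by `σ s`. -/
noncomputable def perturbParam (t : Fin 4 → ℂ) (d : ℕ) (s : ℂ) : Fin 4 → ℂ :=
  ![t 0 * s, t 1 * s ^ (1 - 2 * (d : ℤ)), t 2, t 3]

theorem perturbParam_one : perturbParam t d 1 = t := by
  ext r
  fin_cases r <;> simp [perturbParam]

theorem perturbParam_ne_zero (ht : ∀ r, t r ≠ 0) {s : ℂ} (hs : s ≠ 0) (r : Fin 4) :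
    perturbParam t d s r ≠ 0 := by
  fin_cases r <;> simp [perturbParam, ht, hs, zpow_ne_zero]

theorem perturbParam_balance (hbal : (σ ^ 2) ^ d * ∏ r, t r = σ ^ 2) {s : ℂ} (hs : s ≠ 0) :
    ((σ * s) ^ 2) ^ d * ∏ r, perturbParam t d s r = (σ * s) ^ 2 := by
  have e : (s ^ 2) ^ d * (s * s ^ (1 - 2 * (d : ℤ))) = s ^ 2 := by
    rw [← pow_mul, ← zpow_natCast, ← zpow_one_add₀ hs, ← zpow_add₀ hs, ← zpow_natCast]
    congr 1
    push_cast
    ring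
  rw [Fin.prod_univ_four] at hbal ⊢
  simp only [perturbParam, Matrix.cons_val]
  rw [mul_pow σ, mul_pow]
  linear_combination (s ^ 2) * hbal + (σ ^ 2) ^ d * (t 0 * t 1 * t 2 * t 3) * e

theorem thetaIdentity_of_eventually (hp1 : ‖p‖ < 1) (hσ : σ ≠ 0) (ht : ∀ r, t r ≠ 0)
    (hx : ∀ x ∈ xs, x ≠ 0) (hy : ∀ y ∈ ys, y ≠ 0)
    (h : ∀ᶠ s : ℂ in 𝓝[≠] 1, ThetaIdentity p (σ * s) (perturbParam t d s) d xs ys) :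
    ThetaIdentity p σ t d xs ys := by
  have hS : ContinuousAt (fun s : ℂ => σ * s) 1 := by fun_prop
  have hS0 : σ * 1 ≠ 0 := by rwa [mul_one]
  have hT (r : Fin 4) : ContinuousAt (perturbParam t d · r) 1 := by
    have h1 : ContinuousAt (fun s : ℂ => s ^ (1 - 2 * (d : ℤ))) 1 :=
      continuousAt_zpow₀ _ _ (Or.inl one_ne_zero)
    fin_cases r <;> simp only [perturbParam] <;> fun_prop
  have hT0 (r : Fin 4) : perturbParam t d 1 r ≠ 0 := by rw [perturbParam_one]; exact ht r
  have h1 := continuousAt_thetaSum hp1 hS hS0 hT hT0 hx hy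
  have h2 := (continuousAt_thetaCoeff hp1 hS hS0 hT hT0 xs.length d).mul
    (continuousAt_thetaSum (T := fun s r => σ * s / perturbParam t d s r) hp1 hS hS0
      (fun r => hS.div (hT r) (hT0 r)) (fun r => div_ne_zero hS0 (hT0 r)) hy hx)
  have h3 := tendsto_nhds_unique_of_eventuallyEq (h1.tendsto.mono_left nhdsWithin_le_nhds)
    (h2.tendsto.mono_left nhdsWithin_le_nhds) h
  unfold ThetaIdentity
  simpa only [Pi.mul_apply, perturbParam_one, mul_one] using h3

theorem thetaIdentity_of_thetaGeneric (hp0 : p ≠ 0) (hp1 : ‖p‖ < 1) (hσ : σ ≠ 0)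
    (ht : ∀ r, t r ≠ 0) (hd : xs.length = ys.length + d)
    (hbal : (σ ^ 2) ^ d * ∏ r, t r = σ ^ 2) (hx : ThetaGeneric p xs) (hy : ThetaGeneric p ys) :
    ThetaIdentity p σ t d xs ys := by
  induction xs generalizing σ t d ys with
  | nil =>
    obtain rfl : d = 0 := by simp at hd; omega
    obtain rfl : ys = [] := List.length_eq_zero_iff.1 (by simp at hd; omega)
    simp [ThetaIdentity, thetaSum, thetaCoeff]
  | cons x xs ih =>
    refine thetaIdentity_of_eventually hp1 hσ ht (fun z hz => (hx.1 z hz).1)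
      (fun z hz => (hy.1 z hz).1) ?_
    have h0 : ∀ᶠ s : ℂ in 𝓝[≠] 1, s ≠ 0 :=
      mem_nhdsWithin_of_mem_nhds (isOpen_ne.mem_nhds one_ne_zero)
    cases ys with
    | nil =>
      obtain rfl : d = xs.length + 1 := by simpa using hd.symm
      filter_upwards [h0, eventually_thetaGeneric_mul_cons hp0 hp1 (ht 0) hx.of_cons] with s hs h1
      have hb := perturbParam_balance hbal hs
      have hT := perturbParam_ne_zero (d := xs.length + 1) ht hs
      have hσs := mul_ne_zero hσ hs
      refine thetaIdentity_cons_nil hp0 hp1 hσs hT hb hx h1 (ih hσs (fun r => ?_) (by simp) ?_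
        hx.of_cons hy)
      · by_cases hr : r = 0
        · subst hr
          simpa using ⟨⟨hσ, hs⟩, hT 0⟩
        · simpa [Function.update_of_ne hr] using hT r
      · rw [Fin.prod_univ_four] at hb ⊢
        simp only [Function.update_self, ne_eq, Fin.reduceEq, not_false_eq_true,
          Function.update_of_ne]
        linear_combination hb
    | cons y ys =>
      have h1 : ∀ᶠ s : ℂ in 𝓝[≠] 1, ∀ u ∈ {u | u ∈ (y :: ys) ++ (y :: ys).map (·⁻¹)},
          ThetaGeneric p (σ * s * u :: xs) ∧ ellTheta ((σ * s) ^ 2 * (u * y)) p ≠ 0 := by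
        refine (eventually_all_finite (List.finite_toSet _)).2 fun u hu => ?_
        have hu0 : u ≠ 0 := by
          rcases List.mem_append.1 hu with h | h
          · exact (hy.1 u h).1
          · obtain ⟨v, hv, rfl⟩ := List.mem_map.1 h
            exact inv_ne_zero (hy.1 v hv).1
        have hy0 : y ≠ 0 := (thetaGeneric_cons.1 hy).1.1
        filter_upwards [eventually_thetaGeneric_mul_cons hp0 hp1 (mul_ne_zero hσ hu0) hx.of_cons,
          eventually_ellTheta_mul_pow_ne_zero hp0 hp1 (c := σ ^ 2 * (u * y)) (by positivity)
            two_ne_zero] with s h2 h3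
        exact ⟨by rwa [mul_right_comm], by rwa [mul_pow, mul_right_comm]⟩
      filter_upwards [h0, h1] with s hs h1
      have hd' : xs.length = ys.length + d := by simp at hd; omega
      have hb := perturbParam_balance hbal hs
      have hT := perturbParam_ne_zero (d := d) ht hs
      have hσs := mul_ne_zero hσ hs
      exact thetaIdentity_cons_cons hp0 hp1 hσs hT hd' hb hx hy h1 fun ys' hl hys' =>
        ih hσs hT (hl ▸ hd') hb hx.of_cons hys'

end Induction

theorem thetaGeneric_ofFn {p : ℂ} {n : ℕ} {x : Fin n → ℂ} (h0 : ∀ i, x i ≠ 0)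
    (h2 : ∀ i, ellTheta (x i ^ 2) p ≠ 0)
    (h : ∀ i j, i < j → ellTheta (x i * x j) p ≠ 0 ∧ ellTheta (x i / x j) p ≠ 0) :
    ThetaGeneric p (List.ofFn x) :=
  ⟨List.forall_mem_ofFn_iff.2 fun i => ⟨h0 i, h2 i⟩, List.pairwise_ofFn.2 fun i j => h i j⟩

theorem thetaWeight_ofFn (g : ℂ → ℂ) (σ p : ℂ) {n : ℕ} (y : Fin n → ℂ) (w : ℂ) :
    thetaWeight g σ p (List.ofFn y) w =
      g w * (∏ r, ellTheta (w * y r / σ) p * ellTheta (w / (σ * y r)) p) /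
        (w ^ (n + 1) * ellTheta (w ^ 2) p) := by
  rw [thetaWeight, weightNum, pairProd, List.map_ofFn, List.prod_ofFn, List.length_ofFn, div_div]
  rfl

/-- The theta-function identity underlying the commutation relations between
difference and integral operators; here `σ = q^{1/2}`, i.e. `q = σ²`. -/
theorem diff_int_comm_theta (l m : ℕ) (hlm : l ≤ m) (p σ : ℂ)
    (hp0 : 0 < ‖p‖) (hp1 : ‖p‖ < 1) (hσ0 : σ ≠ 0)
    (t : Fin 4 → ℂ) (x : Fin m → ℂ) (y : Fin l → ℂ)
    (ht0 : ∀ r, t r ≠ 0) (hx0 : ∀ i, x i ≠ 0) (hy0 : ∀ i, y i ≠ 0)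
    (hbal : (σ ^ 2) ^ (m - l) * (t 0 * t 1 * t 2 * t 3) = σ ^ 2)
    (hx2 : ∀ i, ellTheta (x i ^ 2) p ≠ 0)
    (hxij : ∀ i j, i < j → ellTheta (x i * x j) p ≠ 0 ∧ ellTheta (x i / x j) p ≠ 0)
    (hy2 : ∀ i, ellTheta (y i ^ 2) p ≠ 0)
    (hyij : ∀ i j, i < j → ellTheta (y i * y j) p ≠ 0 ∧ ellTheta (y i / y j) p ≠ 0) :
    (∑ ε : Fin m → Bool,
      (∏ i, (ellTheta (t 0 * pw (x i) (ε i)) p * ellTheta (t 1 * pw (x i) (ε i)) p *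
          ellTheta (t 2 * pw (x i) (ε i)) p * ellTheta (t 3 * pw (x i) (ε i)) p) *
        (∏ r, ellTheta (pw (x i) (ε i) * y r / σ) p *
          ellTheta (pw (x i) (ε i) / (σ * y r)) p) /
        (pw (x i) (ε i) ^ (l + 1) * ellTheta (pw (x i) (ε i) ^ 2) p)) *
      ∏ i, ∏ j, if i < j then
        ellTheta (σ ^ 2 * (pw (x i) (ε i) * pw (x j) (ε j))) p /
          ellTheta (pw (x i) (ε i) * pw (x j) (ε j)) p
      else 1) =
    (∏ i ∈ Finset.range (m - l),
      ellTheta ((σ ^ 2) ^ i * (t 0 * t 1)) p * ellTheta ((σ ^ 2) ^ i * (t 0 * t 2)) p *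
        ellTheta ((σ ^ 2) ^ i * (t 0 * t 3)) p / ((-σ) ^ ((m : ℤ) - 1) * t 0)) *
    ∑ δ : Fin l → Bool,
      (∏ i, (ellTheta (σ * pw (y i) (δ i) / t 0) p * ellTheta (σ * pw (y i) (δ i) / t 1) p *
          ellTheta (σ * pw (y i) (δ i) / t 2) p * ellTheta (σ * pw (y i) (δ i) / t 3) p) *
        (∏ r, ellTheta (pw (y i) (δ i) * x r / σ) p *
          ellTheta (pw (y i) (δ i) / (σ * x r)) p) /
        (pw (y i) (δ i) ^ (m + 1) * ellTheta (pw (y i) (δ i) ^ 2) p)) *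
      ∏ i, ∏ j, if i < j then
        ellTheta (σ ^ 2 * (pw (y i) (δ i) * pw (y j) (δ j))) p /
          ellTheta (pw (y i) (δ i) * pw (y j) (δ j)) p
      else 1 := by
  have hp : p ≠ 0 := norm_pos_iff.1 hp0
  have hx : ThetaGeneric p (List.ofFn x) := thetaGeneric_ofFn hx0 hx2 hxij
  have hy : ThetaGeneric p (List.ofFn y) := thetaGeneric_ofFn hy0 hy2 hyij
  have key := thetaIdentity_of_thetaGeneric (d := m - l) hp hp1 hσ0 ht0
    (by simp only [List.length_ofFn]; omega) (by rwa [Fin.prod_univ_four]) hx hy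
  unfold ThetaIdentity thetaSum at key
  rw [← sum_sign_eq_signSum, ← sum_sign_eq_signSum, List.length_ofFn] at key
  simp only [thetaWeight_ofFn, thetaQuad, Fin.prod_univ_four, div_mul_eq_mul_div, thetaCoeff,
    crossRatio] at key
  exact key
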